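/- (Theorem 2.4 (ii).) Under Assumption A, suppose (x₀,ξ₀) is backward nontrapping with respect to k, and let −π < σ < 0. Then there exists a neighborhood Ω of (x₀,ξ₀) such that, uniformly for (x,ξ) ∈ Ω, lim_{λ→∞} π₁( exp(−σH_{p₀}) ∘ exp(σH_p)(x, λξ) ) = π₁(S₋(x,ξ)) and lim_{λ→∞} λ^{−1} π₂( exp(−σH_{p₀}) ∘ exp(σH_p)(x, λξ) ) = π₂(S₋(x,ξ)). -/

import Mathlib

open Real Filter
open scoped BigOperators Topology

noncomputable section

/-- Euclidean configuration space `ℝⁿ`. -/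
abbrev En (n : ℕ) := EuclideanSpace ℝ (Fin n)

/-- Partial derivative `∂f/∂x_j` of a function on `ℝⁿ`. -/
noncomputable def pd {n : ℕ} (f : En n → ℝ) (j : Fin n) (x : En n) : ℝ :=
  fderiv ℝ f x (EuclideanSpace.single j 1)

/-- Japanese bracket `⟨x⟩ = (1+|x|²)^{1/2}` on `ℝⁿ`. -/
noncomputable def jb {n : ℕ} (x : En n) : ℝ := Real.sqrt (1 + ‖x‖ ^ 2)

/-- Japanese bracket `⟨t⟩` on `ℝ`. -/
noncomputable def jbR (t : ℝ) : ℝ := Real.sqrt (1 + t ^ 2)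

/-- Kronecker delta. -/
def kdelta {n : ℕ} (j k : Fin n) : ℝ := if j = k then 1 else 0

/-- Assumption A: smooth symmetric positive-definite coefficients `a_{jk}` which are a
short-range perturbation of `δ_{jk}`, and a potential `V = O(⟨x⟩^{2-μ})`, with symbol-type
bounds on all derivatives. -/
structure AssumptionA (n : ℕ) (a : Fin n → Fin n → En n → ℝ) (V : En n → ℝ) (μ : ℝ) : Prop where
  n_pos : 0 < n
  one_lt_mu : 1 < μ
  smooth_a : ∀ j k, ContDiff ℝ (⊤ : ℕ∞) (a j k)
  smooth_V : ContDiff ℝ (⊤ : ℕ∞) V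
  symm : ∀ j k x, a j k x = a k j x
  posdef : ∀ x (ξ : En n), ξ ≠ 0 → 0 < ∑ j, ∑ k, a j k x * ξ j * ξ k
  decay_a : ∀ (m : ℕ) (j k : Fin n), ∃ C > 0, ∀ x,
      ‖iteratedFDeriv ℝ m (fun y => a j k y - kdelta j k) x‖ ≤ C * jb x ^ (-μ - (m : ℝ))
  decay_V : ∀ (m : ℕ), ∃ C > 0, ∀ x,
      ‖iteratedFDeriv ℝ m V x‖ ≤ C * jb x ^ (2 - μ - (m : ℝ))

/-- Kinetic energy symbol `k(x,ξ) = ½ Σ a_{jk}(x) ξ_j ξ_k`. -/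
noncomputable def ksym {n : ℕ} (a : Fin n → Fin n → En n → ℝ) (x ξ : En n) : ℝ :=
  (1 / 2) * ∑ j, ∑ k, a j k x * ξ j * ξ k

/-- Full symbol `p(x,ξ) = k(x,ξ) + ½|x|² + V(x)`. -/
noncomputable def psym {n : ℕ} (a : Fin n → Fin n → En n → ℝ) (V : En n → ℝ) (x ξ : En n) : ℝ :=
  ksym a x ξ + ‖x‖ ^ 2 / 2 + V x

/-- Scaled symbol `p^λ(x,ξ) = k(x,ξ) + |x|²/(2λ²) + V(x)/λ²`. -/
noncomputable def plam {n : ℕ} (a : Fin n → Fin n → En n → ℝ) (V : En n → ℝ) (lam : ℝ)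
    (x ξ : En n) : ℝ :=
  ksym a x ξ + ‖x‖ ^ 2 / (2 * lam ^ 2) + V x / lam ^ 2

/-- `(y,η)` is a (global) solution of the Hamilton equations of `k(x,ξ)=½Σa_{jk}(x)ξ_jξ_k`. -/
def IsFlowK {n : ℕ} (a : Fin n → Fin n → En n → ℝ) (y η : ℝ → En n) : Prop :=
  (∀ t (j : Fin n), HasDerivAt (fun s => y s j) (∑ i, a j i (y t) * η t i) t) ∧
  (∀ t (j : Fin n), HasDerivAt (fun s => η s j)
      (-((1 / 2) * ∑ i, ∑ l, pd (a i l) j (y t) * η t i * η t l)) t)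

/-- `(y,η)` is a (global) solution of the Hamilton equations of `p(x,ξ)`. -/
def IsFlowP {n : ℕ} (a : Fin n → Fin n → En n → ℝ) (V : En n → ℝ) (y η : ℝ → En n) : Prop :=
  (∀ t (j : Fin n), HasDerivAt (fun s => y s j) (∑ i, a j i (y t) * η t i) t) ∧
  (∀ t (j : Fin n), HasDerivAt (fun s => η s j)
      (-((1 / 2) * ∑ i, ∑ l, pd (a i l) j (y t) * η t i * η t l + y t j + pd V j (y t))) t)

/-- `(y,η)` is a (global) solution of the Hamilton equations of `p^λ(x,ξ)`. -/
def IsFlowPlam {n : ℕ} (a : Fin n → Fin n → En n → ℝ) (V : En n → ℝ) (lam : ℝ)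
    (y η : ℝ → En n) : Prop :=
  (∀ t (j : Fin n), HasDerivAt (fun s => y s j) (∑ i, a j i (y t) * η t i) t) ∧
  (∀ t (j : Fin n), HasDerivAt (fun s => η s j)
      (-((1 / 2) * ∑ i, ∑ l, pd (a i l) j (y t) * η t i * η t l
          + y t j / lam ^ 2 + pd V j (y t) / lam ^ 2)) t)

/-- First (position) component of `exp(-tH_{p₀^λ})` applied to `(y t, η t)`:
`z^λ(t) = cos(t/λ) y^λ(t) − λ sin(t/λ) η^λ(t)`. -/
noncomputable def zlam {n : ℕ} (lam : ℝ) (y η : ℝ → En n) (t : ℝ) : En n :=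
  Real.cos (t / lam) • y t - (lam * Real.sin (t / lam)) • η t

/-- Second (momentum) component: `ζ^λ(t) = λ⁻¹ sin(t/λ) y^λ(t) + cos(t/λ) η^λ(t)`. -/
noncomputable def zetalam {n : ℕ} (lam : ℝ) (y η : ℝ → En n) (t : ℝ) : En n :=
  (lam⁻¹ * Real.sin (t / lam)) • y t + Real.cos (t / lam) • η t

end

/-- The solution `s ↦ sin (ε s) / ε` of `f'' = -ε² f`, `f 0 = 0`, `f' 0 = 1`, extended by `s` to
`ε = 0`. -/
noncomputable def oscSin (ε s : ℝ) : ℝ := if ε = 0 then s else Real.sin (ε * s) / ε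

theorem mul_oscSin (ε s : ℝ) : ε * oscSin ε s = Real.sin (ε * s) := by
  unfold oscSin
  split_ifs with h
  · simp [h]
  · field_simp

theorem hasDerivAt_oscSin (ε s : ℝ) : HasDerivAt (oscSin ε) (Real.cos (ε * s)) s := by
  by_cases h : ε = 0
  · have : oscSin ε = fun s => s := by
      funext s
      simp [oscSin, h]
    rw [this, h]
    simpa using hasDerivAt_id' s
  · have : oscSin ε = fun s => Real.sin (ε * s) / ε := by
      funext s
      simp [oscSin, h]
    rw [this]
    have h1 := (((hasDerivAt_id' s).const_mul ε).sin).div_const ε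
    convert! h1 using 1
    field_simp

theorem oscSin_eq_mul_sinc (ε s : ℝ) : oscSin ε s = s * Real.sinc (ε * s) := by
  unfold oscSin
  split_ifs with h
  · simp [h]
  · rcases eq_or_ne s 0 with rfl | hs
    · simp
    · rw [Real.sinc_of_ne_zero (mul_ne_zero h hs)]
      field_simp

theorem abs_oscSin_le (ε : ℝ) {s : ℝ} (hs : 0 ≤ s) : |oscSin ε s| ≤ s := by
  unfold oscSin
  split_ifs with h
  · rw [abs_of_nonneg hs]
  · rw [abs_div, div_le_iff₀ (abs_pos.mpr h)]
    calc |Real.sin (ε * s)| ≤ |ε * s| := Real.abs_sin_le_abs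
      _ = s * |ε| := by rw [abs_mul, abs_of_nonneg hs, mul_comm]

theorem mul_sin_le_mul_sin {τ θ : ℝ} (hτ : τ ≤ π) (h0 : 0 ≤ θ) (hθ : θ ≤ τ) :
    θ * Real.sin τ ≤ τ * Real.sin θ := by
  rcases eq_or_lt_of_le (h0.trans hθ) with h | hpos
  · have : θ = 0 := le_antisymm (by linarith) h0
    simp [← h, this]
  · have ha : 0 ≤ 1 - θ / τ := by
      rw [sub_nonneg, div_le_one hpos]
      exact hθ
    have hb : 0 ≤ θ / τ := by positivity
    have hc := strictConcaveOn_sin_Icc.concaveOn.2 ⟨le_rfl, Real.pi_pos.le⟩ ⟨hpos.le, hτ⟩ ha hb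
      (by ring)
    simp only [smul_eq_mul, mul_zero, Real.sin_zero, zero_add] at hc
    rw [div_mul_cancel₀ _ hpos.ne'] at hc
    calc θ * Real.sin τ = τ * (θ / τ * Real.sin τ) := by field_simp
      _ ≤ τ * Real.sin θ := by gcongr

theorem le_oscSin {τ ε s : ℝ} (hτ0 : 0 < τ) (hτ : τ < π) (hε : 0 ≤ ε) (hs : 0 ≤ s)
    (h : ε * s ≤ τ) : Real.sin τ / τ * s ≤ oscSin ε s := by
  unfold oscSin
  split_ifs with h0
  · have : Real.sin τ / τ ≤ 1 := by
      rw [div_le_one hτ0]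
      exact Real.sin_le hτ0.le
    nlinarith
  · have hpos : 0 < ε := lt_of_le_of_ne hε (Ne.symm h0)
    have := mul_sin_le_mul_sin hτ.le (by positivity) h
    rw [le_div_iff₀ hpos, div_mul_eq_mul_div, div_mul_eq_mul_div, div_le_iff₀ hτ0]
    linarith

/-- A continuous function which is positive at `a` and which cannot reach zero for the first time
stays positive. -/
theorem forall_pos_of_continuousOn {φ : ℝ → ℝ} {a b : ℝ} (hφ : ContinuousOn φ (Set.Icc a b))
    (ha : 0 < φ a) (h : ∀ t ∈ Set.Icc a b, (∀ s ∈ Set.Icc a t, 0 ≤ φ s) → 0 < φ t) :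
    ∀ t ∈ Set.Icc a b, 0 < φ t := by
  by_contra! hcon
  obtain ⟨t, ht, hle⟩ := hcon
  have hK : IsCompact (Set.Icc a b ∩ φ ⁻¹' Set.Iic 0) :=
    isCompact_Icc.of_isClosed_subset (hφ.preimage_isClosed_of_isClosed isClosed_Icc isClosed_Iic)
      Set.inter_subset_left
  obtain ⟨m, ⟨hm, hm0⟩, hmin⟩ := hK.exists_isLeast ⟨t, ht, hle⟩
  have ham : a ≠ m := by
    rintro rfl
    exact absurd ha (not_lt.mpr hm0)
  have hcl : IsClosed (Set.Icc a m ∩ φ ⁻¹' Set.Ici 0) :=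
    (hφ.mono (Set.Icc_subset_Icc_right hm.2)).preimage_isClosed_of_isClosed isClosed_Icc
      isClosed_Ici
  have hsub : Set.Ico a m ⊆ Set.Icc a m ∩ φ ⁻¹' Set.Ici 0 := by
    intro s hs
    refine ⟨⟨hs.1, hs.2.le⟩, ?_⟩
    by_contra hs0
    have hs1 : φ s < 0 := not_le.mp hs0
    exact absurd (hmin ⟨⟨hs.1, hs.2.le.trans hm.2⟩, hs1.le⟩) (not_le.mpr hs.2)
  have hcl2 := hcl.closure_subset_iff.mpr hsub
  rw [closure_Ico ham] at hcl2
  exact absurd (h m hm fun s hs => (hcl2 hs).2) (not_lt.mpr hm0)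

/-- A bound `‖f'‖ ≤ D (ρ + s)^(-p)`, `p > 1`, integrates to a tail estimate. -/
theorem norm_sub_le_of_norm_deriv_le_rpow {E : Type*} [NormedAddCommGroup E] [NormedSpace ℝ E]
    {f f' : ℝ → E} {D ρ p a b : ℝ} (hD : 0 ≤ D) (hp : 1 < p) (hρ : 0 < ρ + a)
    (hf : ∀ s, HasDerivAt f (f' s) s)
    (hf' : ∀ s ∈ Set.Icc a b, ‖f' s‖ ≤ D * (ρ + s) ^ (-p)) (hab : a ≤ b) :
    ‖f b - f a‖ ≤ D / (p - 1) * (ρ + a) ^ (1 - p) := by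
  have hB : ∀ s ∈ Set.Icc a b, HasDerivAt
      (fun s => D / (p - 1) * ((ρ + a) ^ (1 - p) - (ρ + s) ^ (1 - p))) (D * (ρ + s) ^ (-p)) s := by
    intro s hs
    have hpos : 0 < ρ + s := by linarith [hs.1]
    have h1 := ((hasDerivAt_id' s).const_add ρ).rpow_const (p := 1 - p) (Or.inl hpos.ne')
    have h2 := (h1.const_sub ((ρ + a) ^ (1 - p))).const_mul (D / (p - 1))
    convert! h2 using 1
    have : p - 1 ≠ 0 := by linarith
    rw [show 1 - p - 1 = -p by ring]
    field_simp
    ring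
  have := image_norm_le_of_norm_deriv_right_le_deriv_boundary' (f := fun s => f s - f a) (f' := f')
    (a := a) (b := b) (B' := fun s => D * (ρ + s) ^ (-p))
    (fun s _ => ((hf s).sub_const (f a)).continuousAt.continuousWithinAt)
    (fun s _ => ((hf s).sub_const (f a)).hasDerivWithinAt)
    (B := fun s => D / (p - 1) * ((ρ + a) ^ (1 - p) - (ρ + s) ^ (1 - p)))
    (by simp) (fun s hs => (hB s hs).continuousAt.continuousWithinAt)
    (fun s hs => (hB s ⟨hs.1, hs.2.le⟩).hasDerivWithinAt)
    (fun s hs => hf' s ⟨hs.1, hs.2.le⟩) (x := b) ⟨hab, le_rfl⟩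
  refine this.trans ?_
  have h0 : 0 ≤ D / (p - 1) := div_nonneg hD (by linarith)
  have h1 : 0 ≤ (ρ + b) ^ (1 - p) := Real.rpow_nonneg (by linarith) _
  gcongr
  linarith

/-- Bounds for a short-range perturbation of the free Hamilton equations: `A` and `G` perturb the
velocity and the force, and `W` is the gradient of the additional potential. -/
structure ShortRange {E : Type*} [NormedAddCommGroup E] [InnerProductSpace ℝ E]
    (A G : E → E → E) (W : E → E) (μ C : ℝ) : Prop where
  one_lt : 1 < μ
  pos : 0 < C
  A_le : ∀ r > 0, ∀ y η, r ≤ ‖y‖ → ‖A y η‖ ≤ C * r ^ (-μ) * ‖η‖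
  G_le : ∀ r > 0, ∀ y η, r ≤ ‖y‖ → ‖G y η‖ ≤ C * r ^ (-μ - 1) * ‖η‖ ^ 2
  W_le : ∀ r > 0, ∀ y, r ≤ ‖y‖ → ‖W y‖ ≤ C * r ^ (1 - μ)
  W_bdd : ∀ y, ‖W y‖ ≤ C

/-- Solutions of `y' = η + A(y)η`, `η' = -G(y,η) - ε² (y + W(y))`. -/
def IsScaledSol {E : Type*} [NormedAddCommGroup E] [InnerProductSpace ℝ E]
    (A G : E → E → E) (W : E → E) (ε : ℝ) (y η : ℝ → E) : Prop :=
  (∀ s, HasDerivAt y (η s + A (y s) (η s)) s) ∧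
  (∀ s, HasDerivAt η (-G (y s) (η s) - ε ^ 2 • (y s + W (y s))) s)

/-- Position component of the trajectory pulled back by the oscillator of frequency `ε`. -/
noncomputable def pullPos {E : Type*} [NormedAddCommGroup E] [InnerProductSpace ℝ E]
    (ε : ℝ) (y η : ℝ → E) (s : ℝ) : E :=
  Real.cos (ε * s) • y s - oscSin ε s • η s

/-- Momentum component of the trajectory pulled back by the oscillator of frequency `ε`. -/
noncomputable def pullMom {E : Type*} [NormedAddCommGroup E] [InnerProductSpace ℝ E]
    (ε : ℝ) (y η : ℝ → E) (s : ℝ) : E :=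
  (ε * Real.sin (ε * s)) • y s + Real.cos (ε * s) • η s

section Pull

variable {E : Type*} [NormedAddCommGroup E] [InnerProductSpace ℝ E]
  {A G : E → E → E} {W : E → E} {ε : ℝ} {y η : ℝ → E}

theorem IsScaledSol.hasDerivAt_pullPos (h : IsScaledSol A G W ε y η) (s : ℝ) :
    HasDerivAt (pullPos ε y η) (Real.cos (ε * s) • A (y s) (η s)
      + oscSin ε s • (G (y s) (η s) + ε ^ 2 • W (y s))) s := by
  have hc : HasDerivAt (fun s => Real.cos (ε * s)) (-Real.sin (ε * s) * ε) s := by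
    simpa using ((hasDerivAt_id' s).const_mul ε).cos
  have h1 := (hc.smul (h.1 s)).sub ((hasDerivAt_oscSin ε s).smul (h.2 s))
  convert! h1 using 1
  rw [← mul_oscSin]
  module

theorem IsScaledSol.hasDerivAt_pullMom (h : IsScaledSol A G W ε y η) (s : ℝ) :
    HasDerivAt (pullMom ε y η) ((ε * Real.sin (ε * s)) • A (y s) (η s)
      - Real.cos (ε * s) • (G (y s) (η s) + ε ^ 2 • W (y s))) s := by
  have hc : HasDerivAt (fun s => Real.cos (ε * s)) (-Real.sin (ε * s) * ε) s := by
    simpa using ((hasDerivAt_id' s).const_mul ε).cos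
  have hs : HasDerivAt (fun s => ε * Real.sin (ε * s)) (ε * (Real.cos (ε * s) * ε)) s := by
    simpa using (((hasDerivAt_id' s).const_mul ε).sin).const_mul ε
  have h1 := (hs.smul (h.1 s)).add (hc.smul (h.2 s))
  convert! h1 using 1
  module

theorem eq_cos_smul_pullPos_add (ε : ℝ) (y η : ℝ → E) (s : ℝ) :
    y s = Real.cos (ε * s) • pullPos ε y η s + oscSin ε s • pullMom ε y η s := by
  have h : Real.cos (ε * s) • pullPos ε y η s + oscSin ε s • pullMom ε y η s
      = (Real.cos (ε * s) ^ 2 + (ε * oscSin ε s) * Real.sin (ε * s)) • y s := by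
    unfold pullPos pullMom
    module
  rw [h, mul_oscSin, ← pow_two, Real.cos_sq_add_sin_sq, one_smul]

theorem eq_cos_smul_pullMom_sub (ε : ℝ) (y η : ℝ → E) (s : ℝ) :
    η s = Real.cos (ε * s) • pullMom ε y η s - (ε * Real.sin (ε * s)) • pullPos ε y η s := by
  have h : Real.cos (ε * s) • pullMom ε y η s - (ε * Real.sin (ε * s)) • pullPos ε y η s
      = (Real.cos (ε * s) ^ 2 + (ε * oscSin ε s) * Real.sin (ε * s)) • η s := by
    unfold pullPos pullMom
    module
  rw [h, mul_oscSin, ← pow_two, Real.cos_sq_add_sin_sq, one_smul]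

theorem pullPos_zero (ε : ℝ) (y η : ℝ → E) : pullPos ε y η 0 = y 0 := by
  simp [pullPos, oscSin]

theorem pullMom_zero (ε : ℝ) (y η : ℝ → E) : pullMom ε y η 0 = η 0 := by
  simp [pullMom]

theorem norm_pullPos_le (ε : ℝ) (y η : ℝ → E) {s : ℝ} (hs : 0 ≤ s) :
    ‖pullPos ε y η s‖ ≤ ‖y s‖ + s * ‖η s‖ := by
  refine (norm_sub_le _ _).trans ?_
  rw [norm_smul, norm_smul, Real.norm_eq_abs, Real.norm_eq_abs]
  have h1 := Real.abs_cos_le_one (ε * s)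
  have h2 := abs_oscSin_le ε hs
  calc |Real.cos (ε * s)| * ‖y s‖ + |oscSin ε s| * ‖η s‖
      ≤ 1 * ‖y s‖ + s * ‖η s‖ := by gcongr
    _ = ‖y s‖ + s * ‖η s‖ := by ring

theorem norm_pullMom_le (hε : 0 ≤ ε) (y η : ℝ → E) (s : ℝ) :
    ‖pullMom ε y η s‖ ≤ ε * ‖y s‖ + ‖η s‖ := by
  refine (norm_add_le _ _).trans ?_
  rw [norm_smul, norm_smul, Real.norm_eq_abs, Real.norm_eq_abs, abs_mul, abs_of_nonneg hε]
  have h1 := Real.abs_sin_le_one (ε * s)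
  have h2 := Real.abs_cos_le_one (ε * s)
  calc ε * |Real.sin (ε * s)| * ‖y s‖ + |Real.cos (ε * s)| * ‖η s‖
      ≤ ε * 1 * ‖y s‖ + 1 * ‖η s‖ := by gcongr
    _ = ε * ‖y s‖ + ‖η s‖ := by ring

theorem norm_le_pull (ε : ℝ) (y η : ℝ → E) {s : ℝ} (hs : 0 ≤ s) :
    ‖y s‖ ≤ ‖pullPos ε y η s‖ + s * ‖pullMom ε y η s‖ := by
  conv_lhs => rw [eq_cos_smul_pullPos_add ε y η s]
  refine (norm_add_le _ _).trans ?_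
  rw [norm_smul, norm_smul, Real.norm_eq_abs, Real.norm_eq_abs]
  have h1 := Real.abs_cos_le_one (ε * s)
  have h2 := abs_oscSin_le ε hs
  calc |Real.cos (ε * s)| * ‖pullPos ε y η s‖ + |oscSin ε s| * ‖pullMom ε y η s‖
      ≤ 1 * ‖pullPos ε y η s‖ + s * ‖pullMom ε y η s‖ := by gcongr
    _ = ‖pullPos ε y η s‖ + s * ‖pullMom ε y η s‖ := by ring

theorem IsScaledSol.continuous_prod (h : IsScaledSol A G W ε y η) :
    Continuous fun s => (y s, η s) :=
  (continuous_iff_continuousAt.mpr fun s => (h.1 s).continuousAt).prodMk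
    (continuous_iff_continuousAt.mpr fun s => (h.2 s).continuousAt)

theorem IsScaledSol.comp_const_add (h : IsScaledSol A G W ε y η) (a : ℝ) :
    IsScaledSol A G W ε (fun s => y (a + s)) fun s => η (a + s) :=
  ⟨fun s => (h.1 (a + s)).comp_const_add a s, fun s => (h.2 (a + s)).comp_const_add a s⟩

end Pull

theorem ShortRange.exists_pull_bound {E : Type*} [NormedAddCommGroup E] [InnerProductSpace ℝ E]
    {A G : E → E → E} {W : E → E} {μ C c M τ : ℝ} (hS : ShortRange A G W μ C) (hc : 0 < c)
    (hM : 0 ≤ M) (hτ : 0 ≤ τ) :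
    ∃ D > 0, ∀ ρ ε : ℝ, ∀ y η : ℝ → E, IsScaledSol A G W ε y η → 0 < ρ → 0 ≤ ε → ε * ρ ≤ 1 →
      ∀ a b : ℝ, 0 ≤ a → a ≤ b → ε * b ≤ τ →
      (∀ s ∈ Set.Icc a b, c * (ρ + s) ≤ ‖y s‖ ∧ ‖η s‖ ≤ M) →
      ‖pullPos ε y η b - pullPos ε y η a‖ ≤ D * (ρ + a) ^ (1 - μ) ∧
      ‖pullMom ε y η b - pullMom ε y η a‖ ≤ D * (ρ + a) ^ (-μ) := by
  obtain ⟨P, hP⟩ : ∃ P, P = C * c ^ (-μ) * M := ⟨_, rfl⟩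
  obtain ⟨Q, hQ⟩ : ∃ Q, Q = C * c ^ (-μ - 1) * M ^ 2 + (1 + τ) ^ 2 * (C * c ^ (1 - μ)) := ⟨_, rfl⟩
  have hC := hS.pos
  have hμ := hS.one_lt
  have hP0 : 0 ≤ P := by rw [hP]; positivity
  have hQ0 : 0 ≤ Q := by rw [hQ]; positivity
  obtain ⟨D', hD'⟩ : ∃ D', D' = (1 + τ) * P + Q := ⟨_, rfl⟩
  have hD'0 : 0 ≤ D' := by rw [hD']; positivity
  have hμ1 : 0 < μ - 1 := by linarith
  refine ⟨D' / (μ - 1) + 1, by positivity, ?_⟩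
  intro ρ ε y η hsol hρ hε hερ a b ha hab hb hbd
  have key : ∀ s ∈ Set.Icc a b, ‖A (y s) (η s)‖ ≤ P * (ρ + s) ^ (-μ) ∧
      ‖G (y s) (η s) + ε ^ 2 • W (y s)‖ ≤ Q * (ρ + s) ^ (-(μ + 1)) ∧ ε * (ρ + s) ≤ 1 + τ := by
    intro s hs
    obtain ⟨hy, hη⟩ := hbd s hs
    have hw : 0 < ρ + s := by linarith [hs.1]
    have hr : 0 < c * (ρ + s) := by positivity
    have hεw : ε * (ρ + s) ≤ 1 + τ := by nlinarith [hs.2]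
    refine ⟨?_, ?_, hεw⟩
    · refine (hS.A_le _ hr _ _ hy).trans ?_
      rw [Real.mul_rpow hc.le hw.le, hP]
      calc C * (c ^ (-μ) * (ρ + s) ^ (-μ)) * ‖η s‖ ≤ C * (c ^ (-μ) * (ρ + s) ^ (-μ)) * M := by
            gcongr
        _ = _ := by ring
    · have h1 := hS.G_le _ hr _ (η s) hy
      have h2 := hS.W_le _ hr _ hy
      rw [Real.mul_rpow hc.le hw.le] at h1 h2
      have h3 : (ρ + s) ^ (1 - μ) = (ρ + s) ^ 2 * (ρ + s) ^ (-(μ + 1)) := by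
        rw [← Real.rpow_natCast, ← Real.rpow_add hw]
        congr 1
        push_cast
        ring
      have h4 : -μ - 1 = -(μ + 1) := by ring
      calc ‖G (y s) (η s) + ε ^ 2 • W (y s)‖ ≤ ‖G (y s) (η s)‖ + ε ^ 2 * ‖W (y s)‖ := by
            refine (norm_add_le _ _).trans ?_
            rw [norm_smul, Real.norm_of_nonneg (by positivity)]
        _ ≤ C * (c ^ (-μ - 1) * (ρ + s) ^ (-μ - 1)) * M ^ 2
            + ε ^ 2 * (C * (c ^ (1 - μ) * (ρ + s) ^ (1 - μ))) := by
            refine add_le_add (h1.trans ?_) ?_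
            · gcongr
            · gcongr
        _ = C * c ^ (-μ - 1) * M ^ 2 * (ρ + s) ^ (-(μ + 1))
            + (ε * (ρ + s)) ^ 2 * (C * c ^ (1 - μ)) * (ρ + s) ^ (-(μ + 1)) := by
            rw [h3, h4]
            ring
        _ ≤ C * c ^ (-μ - 1) * M ^ 2 * (ρ + s) ^ (-(μ + 1))
            + (1 + τ) ^ 2 * (C * c ^ (1 - μ)) * (ρ + s) ^ (-(μ + 1)) := by
            gcongr
        _ = Q * (ρ + s) ^ (-(μ + 1)) := by
            rw [hQ]
            ring
  have hsplit : ∀ s ∈ Set.Icc a b, (ρ + s) ^ (-μ) = (ρ + s) * (ρ + s) ^ (-(μ + 1)) := by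
    intro s hs
    have hw : 0 < ρ + s := by linarith [hs.1]
    conv_rhs => rw [← Real.rpow_one (ρ + s), Real.rpow_one, ← Real.rpow_one_add' hw.le (by linarith)]
    congr 1
    ring
  have hwa : 0 < ρ + a := by linarith
  constructor
  · have h := norm_sub_le_of_norm_deriv_le_rpow (D := D') hD'0 hμ hwa hsol.hasDerivAt_pullPos
      (b := b) ?_ hab
    · refine h.trans ?_
      gcongr
      linarith
    · intro s hs
      obtain ⟨h1, h2, h3⟩ := key s hs
      have hs0 : 0 ≤ s := ha.trans hs.1
      have hw : 0 < ρ + s := by linarith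
      calc ‖Real.cos (ε * s) • A (y s) (η s) + oscSin ε s • (G (y s) (η s) + ε ^ 2 • W (y s))‖
          ≤ 1 * (P * (ρ + s) ^ (-μ)) + (ρ + s) * (Q * (ρ + s) ^ (-(μ + 1))) := by
            refine (norm_add_le _ _).trans ?_
            rw [norm_smul, norm_smul, Real.norm_eq_abs, Real.norm_eq_abs]
            have := (abs_oscSin_le ε hs0).trans (show s ≤ ρ + s by linarith)
            have := Real.abs_cos_le_one (ε * s)
            gcongr
        _ = (P + Q) * (ρ + s) ^ (-μ) := by
            rw [hsplit s hs]
            ring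
        _ ≤ D' * (ρ + s) ^ (-μ) := by
            gcongr
            rw [hD']
            nlinarith
  · have h := norm_sub_le_of_norm_deriv_le_rpow (D := D') (p := μ + 1) hD'0 (by linarith) hwa
      hsol.hasDerivAt_pullMom (b := b) ?_ hab
    · refine h.trans ?_
      rw [show 1 - (μ + 1) = -μ by ring, show μ + 1 - 1 = μ by ring]
      have : D' / μ ≤ D' / (μ - 1) := by
        gcongr
        linarith
      gcongr
      linarith
    · intro s hs
      obtain ⟨h1, h2, h3⟩ := key s hs
      have hs0 : 0 ≤ s := ha.trans hs.1
      have hw : 0 < ρ + s := by linarith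
      calc ‖(ε * Real.sin (ε * s)) • A (y s) (η s)
            - Real.cos (ε * s) • (G (y s) (η s) + ε ^ 2 • W (y s))‖
          ≤ (ε * 1) * (P * (ρ + s) ^ (-μ)) + 1 * (Q * (ρ + s) ^ (-(μ + 1))) := by
            refine (norm_sub_le _ _).trans ?_
            rw [norm_smul, norm_smul, Real.norm_eq_abs, Real.norm_eq_abs, abs_mul, abs_of_nonneg hε]
            have := Real.abs_sin_le_one (ε * s)
            have := Real.abs_cos_le_one (ε * s)
            gcongr
        _ = (ε * (ρ + s)) * P * (ρ + s) ^ (-(μ + 1)) + Q * (ρ + s) ^ (-(μ + 1)) := by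
            rw [hsplit s hs]
            ring
        _ ≤ (1 + τ) * P * (ρ + s) ^ (-(μ + 1)) + Q * (ρ + s) ^ (-(μ + 1)) := by
            gcongr
        _ = D' * (ρ + s) ^ (-(μ + 1)) := by
            rw [hD']
            ring

theorem exists_le_norm_cos_smul_add {e τ : ℝ} (he : 0 < e) (hτ0 : 0 < τ) (hτ : τ < π) :
    ∃ c > 0, c ≤ 1 ∧ ∀ ρ > 0, ∀ B : ℝ, ∃ ε₀ > 0, ∀ ε, 0 ≤ ε → ε ≤ ε₀ →
      ∀ {E : Type} [NormedAddCommGroup E] [InnerProductSpace ℝ E] (Y H : E),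
      ρ ≤ ‖Y‖ → ‖Y‖ ≤ B → e ≤ ‖H‖ → -(1 / 4) * (‖Y‖ * ‖H‖) ≤ inner ℝ Y H →
      ∀ s, 0 ≤ s → ε * s ≤ τ → c * (ρ + s) ≤ ‖Real.cos (ε * s) • Y + oscSin ε s • H‖ := by
  have hsin : 0 < Real.sin τ := Real.sin_pos_of_pos_of_lt_pi hτ0 hτ
  obtain ⟨κ, hκ⟩ : ∃ κ, κ = Real.sin τ / τ * e := ⟨_, rfl⟩
  have hκ0 : 0 < κ := by rw [hκ]; positivity
  refine ⟨min (1 / 4) (κ / 4), by positivity, (min_le_left _ _).trans (by norm_num), ?_⟩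
  obtain ⟨c, hc⟩ : ∃ c, c = min (1 / 4) (κ / 4) := ⟨_, rfl⟩
  have hc0 : 0 < c := by rw [hc]; positivity
  have hc1 : c ≤ 1 / 4 := by rw [hc]; exact min_le_left _ _
  have hc2 : c ≤ κ / 4 := by rw [hc]; exact min_le_right _ _
  rw [← hc]
  intro ρ hρ B
  refine ⟨κ / (2 * (|B| + 1)), by positivity, ?_⟩
  intro ε hε hε0 E _ _ Y H hY hYB hH hang s hs hετ
  have hosc0 : 0 ≤ oscSin ε s := le_trans (by positivity) (le_oscSin hτ0 hτ hε hs hετ)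
  have hosc : κ * s ≤ oscSin ε s * ‖H‖ := by
    have h1 := le_oscSin hτ0 hτ hε hs hετ
    have h2 : 0 ≤ Real.sin τ / τ * s := by positivity
    calc κ * s = Real.sin τ / τ * s * e := by rw [hκ]; ring
      _ ≤ oscSin ε s * ‖H‖ := by gcongr
  rcases le_or_gt (ε * s) 1 with h1 | h1
  · have hcos : 1 / 2 ≤ Real.cos (ε * s) := by
      rw [← Real.cos_pi_div_three]
      apply Real.cos_le_cos_of_nonneg_of_le_pi (by positivity) (by linarith [Real.pi_pos])
      linarith [Real.pi_gt_three]
    have hsq : (3 / 4) * ((Real.cos (ε * s) * ‖Y‖) ^ 2 + (oscSin ε s * ‖H‖) ^ 2)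
        ≤ ‖Real.cos (ε * s) • Y + oscSin ε s • H‖ ^ 2 := by
      rw [norm_add_sq_real, norm_smul, norm_smul, real_inner_smul_left, real_inner_smul_right,
        Real.norm_of_nonneg hosc0, Real.norm_of_nonneg (by linarith)]
      have hm : 0 ≤ Real.cos (ε * s) * oscSin ε s := mul_nonneg (by linarith) hosc0
      have := mul_le_mul_of_nonneg_left hang hm
      nlinarith [sq_nonneg (Real.cos (ε * s) * ‖Y‖ - oscSin ε s * ‖H‖)]
    have hYρ : ρ / 2 ≤ Real.cos (ε * s) * ‖Y‖ := by nlinarith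
    have hA : (ρ / 2) ^ 2 ≤ (Real.cos (ε * s) * ‖Y‖) ^ 2 := by gcongr
    have hB : (κ * s) ^ 2 ≤ (oscSin ε s * ‖H‖) ^ 2 := by gcongr
    refine le_of_sq_le_sq ?_ (norm_nonneg _)
    refine le_trans ?_ hsq
    have hC : (c * ρ) ^ 2 ≤ (ρ / 4) ^ 2 := by
      have : c * ρ ≤ ρ / 4 := by nlinarith
      gcongr
    have hD : (c * s) ^ 2 ≤ (κ * s / 4) ^ 2 := by
      have : c * s ≤ κ * s / 4 := by nlinarith
      gcongr
    nlinarith [sq_nonneg (c * ρ - c * s)]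
  · have hlow : oscSin ε s * ‖H‖ - ‖Y‖ ≤ ‖Real.cos (ε * s) • Y + oscSin ε s • H‖ := by
      have h2 := norm_sub_le (Real.cos (ε * s) • Y + oscSin ε s • H) (Real.cos (ε * s) • Y)
      rw [add_sub_cancel_left, norm_smul, norm_smul, Real.norm_of_nonneg hosc0,
        Real.norm_eq_abs] at h2
      have : |Real.cos (ε * s)| * ‖Y‖ ≤ 1 * ‖Y‖ := by
        gcongr
        exact Real.abs_cos_le_one _
      linarith
    refine le_trans ?_ hlow
    have hB : 0 < |B| + 1 := by positivity
    have h3 : 2 * (|B| + 1) ≤ κ * s := by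
      rw [le_div_iff₀ (by positivity)] at hε0
      have h4 := mul_le_mul_of_nonneg_right hε0 hs
      nlinarith
    have := le_abs_self B
    nlinarith

/-- Far away and with the momentum not pointing too much inwards, trajectories escape at least
linearly, uniformly in `ε`, as long as the rotation angle `ε s` stays below `τ < π`. -/
theorem ShortRange.exists_escape {E : Type} [NormedAddCommGroup E] [InnerProductSpace ℝ E]
    {A G : E → E → E} {W : E → E} {μ C e₁ e₂ τ : ℝ} (hS : ShortRange A G W μ C) (he : 0 < e₁)
    (he₂ : 0 ≤ e₂) (hτ0 : 0 < τ) (hτ : τ < π) :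
    ∃ c > 0, ∃ ρ₀ : ℝ, ∀ ρ, ρ₀ ≤ ρ → ∀ B : ℝ, ∃ ε₀ > 0, ∀ ε, 0 ≤ ε → ε ≤ ε₀ →
      ∀ y η : ℝ → E, IsScaledSol A G W ε y η → ρ ≤ ‖y 0‖ → ‖y 0‖ ≤ B → e₁ ≤ ‖η 0‖ → ‖η 0‖ ≤ e₂ →
      -(1 / 4) * (‖y 0‖ * ‖η 0‖) ≤ inner ℝ (y 0) (η 0) →
      ∀ s, 0 ≤ s → ε * s ≤ τ → c * (ρ + s) ≤ ‖y s‖ ∧ ‖η s‖ ≤ e₂ + 3 := by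
  obtain ⟨c, hc, hc1, hfree⟩ := exists_le_norm_cos_smul_add he hτ0 hτ
  obtain ⟨D, hD, hpull⟩ := hS.exists_pull_bound (c := c / 2) (M := e₂ + 3) (τ := τ) (by positivity)
    (by positivity) hτ0.le
  have hμ := hS.one_lt
  refine ⟨c / 2, by positivity, max 1 (4 * D / c), ?_⟩
  intro ρ hρ B
  have hρ1 : 1 ≤ ρ := (le_max_left _ _).trans hρ
  have hρD : 4 * D / c ≤ ρ := (le_max_right _ _).trans hρ
  have hρ0 : 0 < ρ := by linarith
  have hsmall : D * ρ ^ (-μ) ≤ c / 4 := by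
    have h1 : ρ ^ (-μ) ≤ ρ⁻¹ := by
      rw [← Real.rpow_neg_one]
      exact Real.rpow_le_rpow_of_exponent_le hρ1 (by linarith)
    calc D * ρ ^ (-μ) ≤ D * ρ⁻¹ := by gcongr
      _ ≤ c / 4 := by
        rw [div_le_iff₀ hc] at hρD
        rw [← div_eq_mul_inv, div_le_iff₀ hρ0]
        linarith
  have hsmall' : D * ρ ^ (1 - μ) ≤ c / 4 * ρ := by
    have h1 : ρ ^ (1 - μ) = ρ ^ (-μ) * ρ := by
      rw [sub_eq_neg_add, Real.rpow_add_one hρ0.ne']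
    rw [h1, ← mul_assoc]
    gcongr
  obtain ⟨ε₁, hε₁, hfree⟩ := hfree ρ hρ0 B
  refine ⟨min ε₁ (1 / (|B| + ρ)), by positivity, ?_⟩
  intro ε hε hεle y η hsol hy hyB hη hη2 hang T hT hεT
  have hεB : ε * (|B| + ρ) ≤ 1 := by
    rw [← le_div_iff₀ (by positivity)]
    exact hεle.trans (min_le_right _ _)
  have hB0 := abs_nonneg B
  have hBB := le_abs_self B
  have hfree' := hfree ε hε (hεle.trans (min_le_left _ _)) (y 0) (η 0) hy hyB hη hang
  have hyc : Continuous y := continuous_iff_continuousAt.mpr fun s => (hsol.1 s).continuousAt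
  have hηc : Continuous η := continuous_iff_continuousAt.mpr fun s => (hsol.2 s).continuousAt
  have main := forall_pos_of_continuousOn
    (φ := fun s => min (‖y s‖ - c / 2 * (ρ + s)) (e₂ + 3 - ‖η s‖)) (a := 0) (b := T)
    (by fun_prop) ?_ ?_ T ⟨hT, le_rfl⟩
  · rw [lt_min_iff] at main
    exact ⟨by linarith [main.1], by linarith [main.2]⟩
  · rw [lt_min_iff]
    constructor
    · nlinarith
    · linarith
  · intro t ht hbd
    have hεt : ε * t ≤ τ := le_trans (by nlinarith [ht.2]) hεT
    obtain ⟨hz, hζ⟩ := hpull ρ ε y η hsol hρ0 hε (by nlinarith) 0 t le_rfl ht.1 hεt (by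
      intro s hs
      have := hbd s hs
      rw [le_min_iff] at this
      exact ⟨by linarith [this.1], by linarith [this.2]⟩)
    have ht0 : 0 ≤ t := ht.1
    rw [pullPos_zero, add_zero] at hz
    rw [pullMom_zero, add_zero] at hζ
    replace hz := hz.trans hsmall'
    replace hζ := hζ.trans hsmall
    have hcos := Real.abs_cos_le_one (ε * t)
    have hsin := Real.abs_sin_le_one (ε * t)
    have hosc := abs_oscSin_le ε ht.1
    rw [lt_min_iff]
    constructor
    · have h1 := hfree' t ht.1 hεt
      have h2 : ‖y t - (Real.cos (ε * t) • y 0 + oscSin ε t • η 0)‖ ≤ c / 4 * (ρ + t) := by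
        have heq : y t - (Real.cos (ε * t) • y 0 + oscSin ε t • η 0)
            = Real.cos (ε * t) • (pullPos ε y η t - y 0)
              + oscSin ε t • (pullMom ε y η t - η 0) := by
          conv_lhs => rw [eq_cos_smul_pullPos_add ε y η t]
          module
        rw [heq]
        refine (norm_add_le _ _).trans ?_
        rw [norm_smul, norm_smul, Real.norm_eq_abs, Real.norm_eq_abs]
        calc |Real.cos (ε * t)| * ‖pullPos ε y η t - y 0‖
              + |oscSin ε t| * ‖pullMom ε y η t - η 0‖
            ≤ 1 * (c / 4 * ρ) + t * (c / 4) := by gcongr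
          _ = c / 4 * (ρ + t) := by ring
      have h3 := norm_sub_norm_le (Real.cos (ε * t) • y 0 + oscSin ε t • η 0) (y t)
      rw [norm_sub_rev] at h3
      have h4 : 0 < c / 4 * (ρ + t) := by positivity
      nlinarith
    · have hη1 : ‖η t‖ ≤ 1 * ‖pullMom ε y η t‖ + (ε * 1) * ‖pullPos ε y η t‖ := by
        conv_lhs => rw [eq_cos_smul_pullMom_sub ε y η t]
        refine (norm_sub_le _ _).trans ?_
        rw [norm_smul, norm_smul, Real.norm_eq_abs, Real.norm_eq_abs, abs_mul, abs_of_nonneg hε]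
        gcongr
      have h1 := norm_sub_norm_le (pullPos ε y η t) (y 0)
      have h2 := norm_sub_norm_le (pullMom ε y η t) (η 0)
      have h3 : ‖pullPos ε y η t‖ ≤ |B| + ρ := by nlinarith
      have h4 : ε * ‖pullPos ε y η t‖ ≤ 1 := le_trans (by gcongr) hεB
      linarith

/-- The Hamiltonian vector field of the kinetic energy. -/
def kineticField {E : Type*} [NormedAddCommGroup E] [InnerProductSpace ℝ E] (A G : E → E → E)
    (p : E × E) : E × E :=
  (p.2 + A p.1 p.2, -G p.1 p.2)

section Comparison

variable {E : Type*} [NormedAddCommGroup E] [InnerProductSpace ℝ E]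
  {A G : E → E → E} {W : E → E} {μ C : ℝ}

theorem ShortRange.dist_le_of_mem_closedBall (hS : ShortRange A G W μ C) {K : NNReal} {B : ℝ}
    (hK : LipschitzOnWith K (kineticField A G) (Metric.closedBall 0 B)) {ε δ T : ℝ}
    {y η y' η' : ℝ → E} (h : IsScaledSol A G W ε y η) (h' : IsScaledSol A G W 0 y' η')
    (hB : ∀ t ∈ Set.Icc 0 T, ‖(y t, η t)‖ ≤ B) (hB' : ∀ t ∈ Set.Icc 0 T, ‖(y' t, η' t)‖ ≤ B)
    (h0 : dist (y 0, η 0) (y' 0, η' 0) ≤ δ) :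
    ∀ t ∈ Set.Icc 0 T, dist (y t, η t) (y' t, η' t)
      ≤ (δ + ε ^ 2 * (B + C)) * Real.exp ((K + 1) * t) := by
  intro t ht
  have hB0 : 0 ≤ B := (norm_nonneg _).trans (hB t ht)
  have hC := hS.pos
  have hK1 : LipschitzOnWith (K + 1) (kineticField A G) (Metric.closedBall 0 B) :=
    hK.weaken (by simp)
  have hg := dist_le_of_approx_trajectories_ODE_of_mem (v := fun _ => kineticField A G)
    (s := fun _ => Metric.closedBall 0 B) (K := K + 1) (a := 0) (b := T)
    (f := fun s => (y s, η s)) (g := fun s => (y' s, η' s))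
    (f' := fun s => (η s + A (y s) (η s), -G (y s) (η s) - ε ^ 2 • (y s + W (y s))))
    (g' := fun s => kineticField A G (y' s, η' s))
    (εf := ε ^ 2 * (B + C)) (εg := 0) (δ := δ) (fun _ _ => hK1)
    h.continuous_prod.continuousOn
    (fun s _ => ((h.1 s).prodMk (h.2 s)).hasDerivWithinAt) ?_
    (fun s hs => mem_closedBall_zero_iff.mpr (hB s ⟨hs.1, hs.2.le⟩))
    h'.continuous_prod.continuousOn (fun s _ => ?_) (fun s _ => (dist_self _).le)
    (fun s hs => mem_closedBall_zero_iff.mpr (hB' s ⟨hs.1, hs.2.le⟩)) h0 t ht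
  · refine hg.trans ?_
    rw [gronwallBound_of_K_ne_0 (by positivity)]
    simp only [add_zero, sub_zero, NNReal.coe_add, NNReal.coe_one]
    have hx : 1 ≤ Real.exp ((K + 1) * t) := Real.one_le_exp (by have := ht.1; positivity)
    have hp : 0 ≤ ε ^ 2 * (B + C) := by positivity
    have hq : ε ^ 2 * (B + C) / ((K : ℝ) + 1) ≤ ε ^ 2 * (B + C) :=
      div_le_self hp (by simp)
    have hr : ε ^ 2 * (B + C) / ((K : ℝ) + 1) * (Real.exp ((K + 1) * t) - 1)
        ≤ ε ^ 2 * (B + C) * Real.exp ((K + 1) * t) :=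
      mul_le_mul hq (by linarith) (by linarith) hp
    linarith
  · intro s hs
    have h1 : (η s + A (y s) (η s), -G (y s) (η s) - ε ^ 2 • (y s + W (y s)))
        - kineticField A G (y s, η s) = (0, -(ε ^ 2 • (y s + W (y s)))) := by
      rw [kineticField, Prod.mk_sub_mk, sub_self, sub_sub_cancel_left]
    rw [dist_eq_norm, h1, Prod.norm_mk, norm_zero, norm_neg, norm_smul,
      Real.norm_of_nonneg (by positivity)]
    have h2 : ‖y s‖ ≤ B := (norm_fst_le (y s, η s)).trans (hB s ⟨hs.1, hs.2.le⟩)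
    have h3 := (norm_add_le (y s) (W (y s))).trans (add_le_add h2 (hS.W_bdd (y s)))
    refine max_le (by positivity) ?_
    gcongr
  · have := (h'.1 s).prodMk (h'.2 s)
    simp only [ne_eq, OfNat.ofNat_ne_zero, not_false_eq_true, zero_pow, zero_smul, sub_zero] at this
    exact this.hasDerivWithinAt

/-- Continuous dependence on the initial data and on `ε` near `ε = 0`. -/
theorem ShortRange.exists_forall_dist_lt (hS : ShortRange A G W μ C)
    (hLip : ∀ B, ∃ K, LipschitzOnWith K (kineticField A G) (Metric.closedBall 0 B))
    {y₀ η₀ : ℝ → E} (h₀ : IsScaledSol A G W 0 y₀ η₀) (T : ℝ) {r : ℝ} (hr : 0 < r) :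
    ∃ δ > 0, ∃ ε₀ > 0, ∀ ε, 0 ≤ ε → ε ≤ ε₀ → ∀ y η : ℝ → E, IsScaledSol A G W ε y η →
      dist (y 0, η 0) (y₀ 0, η₀ 0) < δ →
      ∀ t ∈ Set.Icc 0 T, dist (y t, η t) (y₀ t, η₀ t) < r := by
  have hC := hS.pos
  obtain ⟨B₀, hB₀⟩ := isCompact_Icc.exists_bound_of_continuousOn
    (h₀.continuous_prod.continuousOn (s := Set.Icc 0 T))
  obtain ⟨B, hB⟩ : ∃ B, B = |B₀| + r := ⟨_, rfl⟩
  have hB0 : 0 ≤ B := by rw [hB]; positivity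
  obtain ⟨K, hK⟩ := hLip B
  obtain ⟨X, hX⟩ : ∃ X, X = Real.exp ((K + 1) * T) := ⟨_, rfl⟩
  have hXpos : 0 < X := by rw [hX]; positivity
  refine ⟨min r (r / (4 * X)), by positivity, min 1 (r / (4 * X) / (B + C)), by positivity, ?_⟩
  intro ε hε hε0 y η h hδ t ht
  have hsmall : (r / (4 * X) + ε ^ 2 * (B + C)) * X < r := by
    have h1 : ε ^ 2 ≤ ε := by nlinarith [hε0.trans (min_le_left _ _)]
    have h2 := hε0.trans (min_le_right _ _)
    rw [le_div_iff₀ (by positivity)] at h2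
    have h3 : ε ^ 2 * (B + C) ≤ r / (4 * X) := le_trans (by gcongr) h2
    calc (r / (4 * X) + ε ^ 2 * (B + C)) * X ≤ (r / (4 * X) + r / (4 * X)) * X := by gcongr
      _ = r / 2 := by field_simp; ring
      _ < r := by linarith
  have hc := h.continuous_prod
  have hc₀ := h₀.continuous_prod
  have main := forall_pos_of_continuousOn
    (φ := fun s => r - dist (y s, η s) (y₀ s, η₀ s)) (a := 0) (b := T) (by fun_prop) ?_ ?_ t ht
  · linarith
  · have := hδ.trans_le (min_le_left _ _)
    linarith
  · intro u hu hle
    have hBu : ∀ s ∈ Set.Icc 0 u, ‖(y₀ s, η₀ s)‖ ≤ |B₀| := fun s hs =>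
      (hB₀ s ⟨hs.1, hs.2.trans hu.2⟩).trans (le_abs_self _)
    have := hS.dist_le_of_mem_closedBall hK (T := u) h h₀ (fun s hs => ?_)
      (fun s hs => by linarith [hBu s hs]) (hδ.le.trans (min_le_right _ _)) u ⟨hu.1, le_rfl⟩
    · have hle : Real.exp ((K + 1) * u) ≤ X := by
        rw [hX]
        have := hu.2
        gcongr
      have : dist (y u, η u) (y₀ u, η₀ u) ≤ (r / (4 * X) + ε ^ 2 * (B + C)) * X :=
        this.trans (by gcongr)
      linarith
    · have h1 := hle s hs
      have h2 := norm_sub_norm_le (y s, η s) (y₀ s, η₀ s)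
      rw [← dist_eq_norm] at h2
      linarith [hBu s hs]

end Comparison

/-- The pulled back trajectory, position and momentum together. -/
noncomputable def pull {E : Type*} [NormedAddCommGroup E] [InnerProductSpace ℝ E]
    (ε : ℝ) (y η : ℝ → E) (s : ℝ) : E × E :=
  (pullPos ε y η s, pullMom ε y η s)

/-- The pull-backs at a fixed time depend continuously on `ε` at `ε = 0`, uniformly over
trajectories which stay in a fixed ball. -/
theorem ShortRange.eventually_dist_pull_lt {E : Type*} [NormedAddCommGroup E]
    [InnerProductSpace ℝ E] {A G : E → E → E} {W : E → E} {μ C : ℝ} (hS : ShortRange A G W μ C)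
    (hLip : ∀ B, ∃ K, LipschitzOnWith K (kineticField A G) (Metric.closedBall 0 B))
    (B : ℝ) {s r : ℝ} (hs : 0 ≤ s) (hr : 0 < r) :
    ∀ᶠ ε in 𝓝[>] (0 : ℝ), ∀ y η y' η' : ℝ → E, IsScaledSol A G W ε y η →
      IsScaledSol A G W 0 y' η' → y 0 = y' 0 → η 0 = η' 0 →
      (∀ t ∈ Set.Icc 0 s, ‖(y t, η t)‖ ≤ B) → (∀ t ∈ Set.Icc 0 s, ‖(y' t, η' t)‖ ≤ B) →
      dist (pull ε y η s) (pull 0 y' η' s) < r := by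
  obtain ⟨K, hK⟩ := hLip B
  obtain ⟨N, hN⟩ : ∃ N : ℝ → ℝ, N = fun ε =>
      (1 + s) * (ε ^ 2 * (B + C) * Real.exp ((K + 1) * s)) + |Real.cos (ε * s) - 1| * B
        + |oscSin ε s - s| * B + |ε| * B := ⟨_, rfl⟩
  have hNc : Continuous N := by
    rw [hN]
    simp only [oscSin_eq_mul_sinc]
    have := Real.continuous_sinc
    fun_prop
  have hN0 : N 0 < r := by
    rw [hN]
    simpa [oscSin] using hr
  filter_upwards [nhdsWithin_le_nhds (hNc.continuousAt.eventually_lt continuousAt_const hN0),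
    self_mem_nhdsWithin] with ε hεN hε0 y η y' η' h h' hy hη hB hB'
  have hss : s ∈ Set.Icc 0 s := ⟨hs, le_rfl⟩
  have hd := hS.dist_le_of_mem_closedBall hK h h' hB hB' (δ := 0) (by rw [hy, hη, dist_self]) s hss
  rw [zero_add, dist_eq_norm, Prod.mk_sub_mk] at hd
  obtain ⟨d, hdd⟩ : ∃ d, d = ε ^ 2 * (B + C) * Real.exp ((K + 1) * s) := ⟨_, rfl⟩
  rw [← hdd] at hd
  have hd1 : ‖y s - y' s‖ ≤ d := (norm_fst_le _).trans hd
  have hd2 : ‖η s - η' s‖ ≤ d := (norm_snd_le _).trans hd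
  have hb1 : ‖y s‖ ≤ B := (norm_fst_le (y s, η s)).trans (hB s hss)
  have hb1' : ‖y' s‖ ≤ B := (norm_fst_le (y' s, η' s)).trans (hB' s hss)
  have hb2' : ‖η' s‖ ≤ B := (norm_snd_le (y' s, η' s)).trans (hB' s hss)
  have hd0 : 0 ≤ d := (norm_nonneg _).trans hd1
  have hB0 : 0 ≤ B := (norm_nonneg _).trans hb1
  have hcos := Real.abs_cos_le_one (ε * s)
  have hsin := Real.abs_sin_le_one (ε * s)
  have hosc := abs_oscSin_le ε hs
  have hp : ‖pullPos ε y η s - pullPos 0 y' η' s‖ ≤ N ε := by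
    have heq : pullPos ε y η s - pullPos 0 y' η' s = Real.cos (ε * s) • (y s - y' s)
        + (Real.cos (ε * s) - 1) • y' s - oscSin ε s • (η s - η' s)
        - (oscSin ε s - s) • η' s := by
      simp only [pullPos, zero_mul, Real.cos_zero, oscSin, if_true]
      module
    rw [heq]
    refine (norm_sub_le _ _).trans ((add_le_add_left ((norm_sub_le _ _).trans
      (add_le_add_left (norm_add_le _ _) _)) _).trans ?_)
    simp only [norm_smul, Real.norm_eq_abs]
    calc _ ≤ 1 * d + |Real.cos (ε * s) - 1| * B + s * d + |oscSin ε s - s| * B := by gcongr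
      _ ≤ N ε := by
        rw [hN]
        simp only [← hdd]
        have : 0 ≤ |ε| * B := by positivity
        linarith
  have hq : ‖pullMom ε y η s - pullMom 0 y' η' s‖ ≤ N ε := by
    have heq : pullMom ε y η s - pullMom 0 y' η' s = (ε * Real.sin (ε * s)) • y s
        + Real.cos (ε * s) • (η s - η' s) + (Real.cos (ε * s) - 1) • η' s := by
      simp only [pullMom, zero_mul, Real.cos_zero]
      module
    rw [heq]
    refine (norm_add_le _ _).trans ((add_le_add_left (norm_add_le _ _) _).trans ?_)
    simp only [norm_smul, Real.norm_eq_abs, abs_mul]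
    calc _ ≤ |ε| * 1 * B + 1 * d + |Real.cos (ε * s) - 1| * B := by gcongr
      _ ≤ N ε := by
        rw [hN]
        simp only [← hdd]
        have : 0 ≤ |oscSin ε s - s| * B := by positivity
        have : 0 ≤ s * d := by positivity
        linarith
  rw [dist_eq_norm, pull, pull, Prod.mk_sub_mk, Prod.norm_mk]
  exact (max_le hp hq).trans_lt hεN

/-- Near an outgoing reference trajectory of the kinetic flow, the wave map of the kinetic flow
exists and is the uniform limit of the pulled back trajectories at rotation angle `τ < π`. -/
theorem ShortRange.exists_waveMap {E : Type} [NormedAddCommGroup E] [InnerProductSpace ℝ E]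
    [CompleteSpace E] {A G : E → E → E} {W : E → E} {μ C e₁ e₂ τ : ℝ}
    (hS : ShortRange A G W μ C)
    (hLip : ∀ B, ∃ K, LipschitzOnWith K (kineticField A G) (Metric.closedBall 0 B))
    (hτ0 : 0 < τ) (hτ : τ < π) (Y H : ℝ → E × E → ℝ → E)
    (hsol : ∀ ε, 0 ≤ ε → ∀ q, IsScaledSol A G W ε (Y ε q) (H ε q) ∧ Y ε q 0 = q.1 ∧ H ε q 0 = q.2)
    (q₀ : E × E) (he : 0 < e₁)
    (hout : ∀ ρ : ℝ, ∃ R, 0 ≤ R ∧ ρ < ‖Y 0 q₀ R‖ ∧ e₁ < ‖H 0 q₀ R‖ ∧ ‖H 0 q₀ R‖ < e₂ ∧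
      -(1 / 4) * (‖Y 0 q₀ R‖ * ‖H 0 q₀ R‖) < inner ℝ (Y 0 q₀ R) (H 0 q₀ R)) :
    ∃ Ω : Set (E × E), IsOpen Ω ∧ q₀ ∈ Ω ∧ ∃ S : E × E → E × E,
      (∀ q ∈ Ω, Tendsto (pull 0 (Y 0 q) (H 0 q)) atTop (𝓝 (S q))) ∧
      TendstoUniformlyOn (fun ε q => pull ε (Y ε q) (H ε q) (τ / ε)) S (𝓝[>] 0) Ω := by
  have hμ := hS.one_lt
  have he₂ : 0 ≤ e₂ := by
    obtain ⟨R, -, -, h1, h2, -⟩ := hout 0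
    linarith
  obtain ⟨c, hc, ρ₀, hesc⟩ := hS.exists_escape he he₂ hτ0 hτ
  obtain ⟨ρ, hρ⟩ : ∃ ρ, ρ = max ρ₀ 1 := ⟨_, rfl⟩
  have hρ1 : 1 ≤ ρ := by rw [hρ]; exact le_max_right _ _
  obtain ⟨R, hR, hoY, hoH1, hoH2, hang⟩ := hout ρ
  obtain ⟨B, hB⟩ : ∃ B, B = ‖Y 0 q₀ R‖ + 1 := ⟨_, rfl⟩
  obtain ⟨ε₁, hε₁, hesc⟩ := hesc ρ (by rw [hρ]; exact le_max_left _ _) B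
  obtain ⟨r, hr, hball⟩ : ∃ r > 0, ∀ p : E × E, dist p (Y 0 q₀ R, H 0 q₀ R) < r →
      ρ ≤ ‖p.1‖ ∧ ‖p.1‖ ≤ B ∧ e₁ ≤ ‖p.2‖ ∧ ‖p.2‖ ≤ e₂ ∧
      -(1 / 4) * (‖p.1‖ * ‖p.2‖) ≤ inner ℝ p.1 p.2 := by
    have hev : ∀ᶠ p : E × E in 𝓝 (Y 0 q₀ R, H 0 q₀ R),
        ρ < ‖p.1‖ ∧ ‖p.1‖ < B ∧ e₁ < ‖p.2‖ ∧ ‖p.2‖ < e₂ ∧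
        -(1 / 4) * (‖p.1‖ * ‖p.2‖) < inner ℝ p.1 p.2 := by
      have c1 : Continuous fun p : E × E => ‖p.1‖ := by fun_prop
      have c2 : Continuous fun p : E × E => ‖p.2‖ := by fun_prop
      have c3 : Continuous fun p : E × E => -(1 / 4) * (‖p.1‖ * ‖p.2‖) := by fun_prop
      have c4 : Continuous fun p : E × E => inner ℝ p.1 p.2 := by fun_prop
      refine (continuousAt_const.eventually_lt c1.continuousAt hoY).and
        ((c1.continuousAt.eventually_lt continuousAt_const ?_).and
        ((continuousAt_const.eventually_lt c2.continuousAt hoH1).and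
        ((c2.continuousAt.eventually_lt continuousAt_const hoH2).and
        (c3.continuousAt.eventually_lt c4.continuousAt hang))))
      rw [hB]
      exact lt_add_one _
    obtain ⟨r, hr, h⟩ := Metric.eventually_nhds_iff.mp hev
    refine ⟨r, hr, fun p hp => ?_⟩
    obtain ⟨h1, h2, h3, h4, h5⟩ := h hp
    exact ⟨h1.le, h2.le, h3.le, h4.le, h5.le⟩
  obtain ⟨δ, hδ, ε₂, hε₂, hnear⟩ := hS.exists_forall_dist_lt hLip (hsol 0 le_rfl q₀).1 R hr
  obtain ⟨B₀, hB₀⟩ := isCompact_Icc.exists_bound_of_continuousOn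
    ((hsol 0 le_rfl q₀).1.continuous_prod.continuousOn (s := Set.Icc 0 R))
  obtain ⟨ε₀, hε₀⟩ : ∃ ε₀, ε₀ = min (min ε₁ ε₂) 1 := ⟨_, rfl⟩
  have hε₀pos : 0 < ε₀ := by rw [hε₀]; positivity
  have hle1 : ε₀ ≤ ε₁ := by rw [hε₀]; exact (min_le_left _ _).trans (min_le_left _ _)
  have hle2 : ε₀ ≤ ε₂ := by rw [hε₀]; exact (min_le_left _ _).trans (min_le_right _ _)
  have hle3 : ε₀ ≤ 1 := by rw [hε₀]; exact min_le_right _ _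
  obtain ⟨M, hM⟩ : ∃ M, M = e₂ + 3 := ⟨_, rfl⟩
  have hM0 : 0 ≤ M := by rw [hM]; positivity
  have hnear' : ∀ ε, 0 ≤ ε → ε ≤ ε₀ → ∀ q ∈ Metric.ball q₀ δ, ∀ t ∈ Set.Icc 0 R,
      dist (Y ε q t, H ε q t) (Y 0 q₀ t, H 0 q₀ t) < r := by
    intro ε hε hεle q hq
    obtain ⟨hs, hs1, hs2⟩ := hsol ε hε q
    refine hnear ε hε (hεle.trans hle2) _ _ hs ?_
    rw [hs1, hs2, (hsol 0 le_rfl q₀).2.1, (hsol 0 le_rfl q₀).2.2]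
    exact hq
  have hlong : ∀ ε, 0 ≤ ε → ε ≤ ε₀ → ∀ q ∈ Metric.ball q₀ δ, ∀ s, R ≤ s → ε * s ≤ τ →
      c / (1 + R) * (1 + s) ≤ ‖Y ε q s‖ ∧ ‖H ε q s‖ ≤ M := by
    intro ε hε hεle q hq s hs hεs
    obtain ⟨h1, h2, h3, h4, h5⟩ := hball _ (hnear' ε hε hεle q hq R ⟨hR, le_rfl⟩)
    have h6 := hesc ε hε (hεle.trans hle1) _ _ ((hsol ε hε q).1.comp_const_add R)
      (by simpa using h1) (by simpa using h2) (by simpa using h3) (by simpa using h4)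
      (by simpa using h5) (s - R) (by linarith) (by nlinarith)
    rw [add_sub_cancel, ← hM] at h6
    refine ⟨le_trans ?_ h6.1, h6.2⟩
    rw [div_mul_eq_mul_div, div_le_iff₀ (by positivity), mul_assoc]
    have : 0 ≤ (s - R) * R := mul_nonneg (by linarith) hR
    gcongr
    nlinarith
  obtain ⟨D, hD, hpull⟩ := hS.exists_pull_bound (c := c / (1 + R)) (M := M) (τ := τ)
    (by positivity) hM0 hτ0.le
  obtain ⟨κ, hκ⟩ : ∃ κ : ℝ → ℝ, κ = fun s => D * (1 + s) ^ (1 - μ) := ⟨_, rfl⟩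
  have hκlim : Tendsto κ atTop (𝓝 0) := by
    rw [hκ, show 1 - μ = -(μ - 1) by ring]
    simpa using ((tendsto_rpow_neg_atTop (show 0 < μ - 1 by linarith)).comp
      (tendsto_atTop_add_const_left atTop 1 tendsto_id)).const_mul D
  have hcauchy : ∀ ε, 0 ≤ ε → ε ≤ ε₀ → ∀ q ∈ Metric.ball q₀ δ, ∀ s t, R ≤ s → s ≤ t → ε * t ≤ τ →
      dist (pull ε (Y ε q) (H ε q) t) (pull ε (Y ε q) (H ε q) s) ≤ κ s := by
    intro ε hε hεle q hq s t hs hst hεt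
    obtain ⟨h1, h2⟩ := hpull 1 ε _ _ (hsol ε hε q).1 one_pos hε (by linarith) s t (hR.trans hs) hst
      hεt (fun u hu => hlong ε hε hεle q hq u (hs.trans hu.1)
        (le_trans (mul_le_mul_of_nonneg_left hu.2 hε) hεt))
    rw [dist_eq_norm, pull, pull, Prod.mk_sub_mk, Prod.norm_mk, hκ]
    refine max_le h1 (h2.trans ?_)
    have : 1 ≤ 1 + s := by linarith
    simp only
    gcongr
    linarith
  have hbound : ∀ s, R ≤ s → ∃ B', ∀ ε, 0 ≤ ε → ε ≤ ε₀ → ε * s ≤ τ → ∀ q ∈ Metric.ball q₀ δ,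
      ∀ t ∈ Set.Icc 0 s, ‖(Y ε q t, H ε q t)‖ ≤ B' := by
    intro s hs
    obtain ⟨b, hb⟩ : ∃ b, b = B₀ + r := ⟨_, rfl⟩
    obtain ⟨L, hL⟩ : ∃ L, L = b + R * b + b + κ R := ⟨_, rfl⟩
    have hs0 : 0 ≤ s := hR.trans hs
    refine ⟨max b (max (L + s * L) M), ?_⟩
    intro ε hε hεle hεs q hq t ht
    have hinit : ∀ u ∈ Set.Icc 0 R, ‖(Y ε q u, H ε q u)‖ ≤ b := by
      intro u hu
      have h1 := hnear' ε hε hεle q hq u hu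
      have h2 := norm_sub_norm_le (Y ε q u, H ε q u) (Y 0 q₀ u, H 0 q₀ u)
      rw [← dist_eq_norm] at h2
      linarith [hB₀ u hu]
    rcases le_total t R with htR | htR
    · exact (hinit t ⟨ht.1, htR⟩).trans (le_max_left _ _)
    · refine le_trans ?_ (le_max_right _ _)
      have hεt : ε * t ≤ τ := le_trans (mul_le_mul_of_nonneg_left ht.2 hε) hεs
      rw [Prod.norm_mk]
      refine max_le_max ?_ (hlong ε hε hεle q hq t htR hεt).2
      have hbR := hinit R ⟨hR, le_rfl⟩
      have hb1 : ‖Y ε q R‖ ≤ b := (norm_fst_le (Y ε q R, H ε q R)).trans hbR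
      have hb2 : ‖H ε q R‖ ≤ b := (norm_snd_le (Y ε q R, H ε q R)).trans hbR
      have hb0 : 0 ≤ b := (norm_nonneg _).trans hb1
      have hd := hcauchy ε hε hεle q hq R t le_rfl htR hεt
      rw [dist_eq_norm] at hd
      have hz := (norm_fst_le _).trans hd
      have hζ := (norm_snd_le _).trans hd
      simp only [pull, Prod.fst_sub, Prod.snd_sub] at hz hζ
      have h1 := norm_pullPos_le ε (Y ε q) (H ε q) hR
      have h2 := norm_pullMom_le hε (Y ε q) (H ε q) R
      have h3 := norm_sub_norm_le (pullPos ε (Y ε q) (H ε q) t) (pullPos ε (Y ε q) (H ε q) R)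
      have h4 := norm_sub_norm_le (pullMom ε (Y ε q) (H ε q) t) (pullMom ε (Y ε q) (H ε q) R)
      have h5 : R * ‖H ε q R‖ ≤ R * b := by gcongr
      have h6 : ε * ‖Y ε q R‖ ≤ 1 * b := by
        have := hεle.trans hle3
        gcongr
      have hRb : 0 ≤ R * b := by positivity
      have h7 : ‖pullPos ε (Y ε q) (H ε q) t‖ ≤ L := by linarith
      have h8 : ‖pullMom ε (Y ε q) (H ε q) t‖ ≤ L := by linarith
      refine (norm_le_pull ε (Y ε q) (H ε q) ht.1).trans ?_
      have := ht.2
      gcongr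
  have hlimit : ∀ q ∈ Metric.ball q₀ δ, ∃ l, Tendsto (pull 0 (Y 0 q) (H 0 q)) atTop (𝓝 l) := by
    intro q hq
    refine cauchySeq_tendsto_of_complete (Metric.cauchySeq_iff'.mpr fun e hepos => ?_)
    obtain ⟨s, hs⟩ := ((hκlim.eventually (gt_mem_nhds hepos)).and (eventually_ge_atTop R)).exists
    refine ⟨s, fun t ht => ?_⟩
    exact (hcauchy 0 le_rfl hε₀pos.le q hq s t hs.2 ht (by linarith)).trans_lt hs.1
  choose! S hSlim using hlimit
  refine ⟨Metric.ball q₀ δ, Metric.isOpen_ball, Metric.mem_ball_self hδ, S, hSlim, ?_⟩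
  have hSdist : ∀ q ∈ Metric.ball q₀ δ, ∀ s, R ≤ s →
      dist (S q) (pull 0 (Y 0 q) (H 0 q) s) ≤ κ s := by
    intro q hq s hs
    refine le_of_tendsto ((hSlim q hq).dist tendsto_const_nhds) ?_
    filter_upwards [eventually_ge_atTop s] with t ht
    exact hcauchy 0 le_rfl hε₀pos.le q hq s t hs ht (by linarith)
  rw [Metric.tendstoUniformlyOn_iff]
  intro e hepos
  obtain ⟨s, hκs, hs⟩ := ((hκlim.eventually (gt_mem_nhds (show 0 < e / 4 by positivity))).and
    (eventually_ge_atTop R)).exists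
  have hs0 : 0 ≤ s := hR.trans hs
  obtain ⟨B', hB'⟩ := hbound s hs
  have hsmall : ∀ᶠ ε in 𝓝[>] (0 : ℝ), ε < min ε₀ (τ / (s + 1)) :=
    nhdsWithin_le_nhds (gt_mem_nhds (by positivity))
  filter_upwards [hS.eventually_dist_pull_lt hLip B' hs0 (show 0 < e / 4 by positivity), hsmall,
    self_mem_nhdsWithin] with ε hclose hεsmall hεpos q hq
  have hε : 0 < ε := hεpos
  have hεle : ε ≤ ε₀ := hεsmall.le.trans (min_le_left _ _)
  have hεs : ε * s ≤ τ := by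
    have := hεsmall.le.trans (min_le_right _ _)
    rw [le_div_iff₀ (by positivity)] at this
    linarith
  have hsτ : s ≤ τ / ε := by
    rw [le_div_iff₀ hε]
    linarith
  have h1 := hclose _ _ _ _ (hsol ε hε.le q).1 (hsol 0 le_rfl q).1
    ((hsol ε hε.le q).2.1.trans (hsol 0 le_rfl q).2.1.symm)
    ((hsol ε hε.le q).2.2.trans (hsol 0 le_rfl q).2.2.symm)
    (hB' ε hε.le hεle hεs q hq) (hB' 0 le_rfl hε₀pos.le (by linarith) q hq)
  have h2 := hcauchy ε hε.le hεle q hq s (τ / ε) hs hsτ (by rw [mul_div_cancel₀ _ hε.ne'])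
  have h3 := hSdist q hq s hs
  have h4 := dist_triangle4 (S q) (pull 0 (Y 0 q) (H 0 q) s) (pull ε (Y ε q) (H ε q) s)
    (pull ε (Y ε q) (H ε q) (τ / ε))
  rw [dist_comm (pull 0 (Y 0 q) (H 0 q) s), dist_comm (pull ε (Y ε q) (H ε q) s) (pull ε (Y ε q) (H ε q) (τ / ε))] at h4
  linarith

/-- A trajectory of the kinetic flow of positive energy which escapes to infinity is eventually
outgoing. -/
theorem ShortRange.exists_outgoing {E : Type*} [NormedAddCommGroup E] [InnerProductSpace ℝ E]
    {A G : E → E → E} {W : E → E} {μ C : ℝ} (hS : ShortRange A G W μ C) {y η : ℝ → E}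
    (h : IsScaledSol A G W 0 y η) (hy : Tendsto (fun s => ‖y s‖) atTop atTop) {e : ℝ} (he : 0 < e)
    (hen : ∀ s, inner ℝ (η s) (η s + A (y s) (η s)) = 2 * e ^ 2) (ρ : ℝ) :
    ∃ R, 0 ≤ R ∧ ρ < ‖y R‖ ∧ e < ‖η R‖ ∧ ‖η R‖ < 2 * e ∧
      -(1 / 4) * (‖y R‖ * ‖η R‖) < inner ℝ (y R) (η R) := by
  have hμ := hS.one_lt
  have hC := hS.pos
  obtain ⟨r, hr⟩ : ∃ r, r = max 1 (8 * C) := ⟨_, rfl⟩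
  have hr1 : 1 ≤ r := by rw [hr]; exact le_max_left _ _
  have hrC : 8 * C ≤ r := by rw [hr]; exact le_max_right _ _
  have hr0 : 0 < r := by linarith
  have hA : ∀ s, r ≤ ‖y s‖ → ‖A (y s) (η s)‖ ≤ 1 / 8 * ‖η s‖ := by
    intro s hs
    refine (hS.A_le r hr0 _ _ hs).trans ?_
    gcongr
    calc C * r ^ (-μ) ≤ C * r⁻¹ := by
          gcongr
          rw [← Real.rpow_neg_one]
          exact Real.rpow_le_rpow_of_exponent_le hr1 (by linarith)
      _ ≤ 1 / 8 := by
          rw [← div_eq_mul_inv, div_le_iff₀ hr0]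
          linarith
  obtain ⟨s₁, hs₁⟩ := eventually_atTop.mp
    ((hy.eventually_gt_atTop (max ρ r)).and (eventually_ge_atTop 0))
  obtain ⟨s₂, hlt, hs₂⟩ := ((hy.eventually_gt_atTop ‖y s₁‖).and (eventually_gt_atTop s₁)).exists
  have hder : ∀ s, HasDerivAt (fun s => ‖y s‖ ^ 2)
      (2 * inner ℝ (y s) (η s + A (y s) (η s))) s := fun s => (h.1 s).norm_sq
  obtain ⟨R, hR, hRd⟩ := exists_hasDerivAt_eq_slope (fun s => ‖y s‖ ^ 2) _ hs₂
    (fun s _ => (hder s).continuousAt.continuousWithinAt) (fun s _ => hder s)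
  obtain ⟨hyR, hR0⟩ := hs₁ R hR.1.le
  have hrR : r ≤ ‖y R‖ := (le_max_right _ _).trans hyR.le
  have hAR := hA R hrR
  have hpos : 0 < inner ℝ (y R) (η R + A (y R) (η R)) := by
    have : 0 < (‖y s₂‖ ^ 2 - ‖y s₁‖ ^ 2) / (s₂ - s₁) := by
      apply div_pos _ (by linarith)
      have := norm_nonneg (y s₁)
      nlinarith
    linarith
  have hη := hen R
  rw [inner_add_right, real_inner_self_eq_norm_sq] at hη
  have h1 := abs_le.mp ((abs_real_inner_le_norm (η R) (A (y R) (η R))).trans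
    (mul_le_mul_of_nonneg_left hAR (norm_nonneg _)))
  have h2 := abs_le.mp ((abs_real_inner_le_norm (y R) (A (y R) (η R))).trans
    (mul_le_mul_of_nonneg_left hAR (norm_nonneg _)))
  have h0 := norm_nonneg (η R)
  refine ⟨R, hR0, (le_max_left _ _).trans_lt hyR, ?_, ?_, ?_⟩
  · by_contra! hle
    nlinarith
  · by_contra! hle
    nlinarith
  · rw [inner_add_right] at hpos
    have : 0 ≤ ‖y R‖ * ‖η R‖ := by positivity
    nlinarith

/-- The deviation of the metric `a` from the Euclidean one, as a map `(y, η) ↦ (a(y) - 1) η`. -/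
noncomputable def metricDev {n : ℕ} (a : Fin n → Fin n → En n → ℝ) (y η : En n) : En n :=
  WithLp.toLp 2 fun j => ∑ i, (a j i y - kdelta j i) * η i

/-- The `x`-gradient of the kinetic energy `k(x,ξ)`. -/
noncomputable def kineticGrad {n : ℕ} (a : Fin n → Fin n → En n → ℝ) (y η : En n) : En n :=
  WithLp.toLp 2 fun j => (1 / 2) * ∑ i, ∑ l, pd (a i l) j y * η i * η l

/-- The Euclidean gradient of `V`. -/
noncomputable def pdGrad {n : ℕ} (V : En n → ℝ) (y : En n) : En n :=
  WithLp.toLp 2 fun j => pd V j y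

section

variable {n : ℕ} {a : Fin n → Fin n → En n → ℝ} {V : En n → ℝ} {μ : ℝ}

theorem metricDev_apply (y η : En n) (j : Fin n) :
    metricDev a y η j = ∑ i, (a j i y - kdelta j i) * η i := rfl

theorem kineticGrad_apply (y η : En n) (j : Fin n) :
    kineticGrad a y η j = (1 / 2) * ∑ i, ∑ l, pd (a i l) j y * η i * η l := rfl

theorem add_metricDev_apply (y η : En n) (j : Fin n) :
    (η + metricDev a y η) j = ∑ i, a j i y * η i := by
  rw [PiLp.add_apply, metricDev_apply]
  simp [sub_mul, kdelta, Finset.sum_sub_distrib]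

theorem norm_le_mul_of_abs_apply_le {v : En n} {b : ℝ} (hb : 0 ≤ b) (h : ∀ j, |v j| ≤ b) :
    ‖v‖ ≤ n * b := by
  have h1 : ‖v‖ ^ 2 ≤ (n * b) ^ 2 := by
    rw [EuclideanSpace.norm_sq_eq]
    calc ∑ i, ‖v i‖ ^ 2 ≤ ∑ _i : Fin n, b ^ 2 :=
          Finset.sum_le_sum fun i _ => pow_le_pow_left₀ (norm_nonneg _) (h i) 2
      _ = n * b ^ 2 := by simp
      _ ≤ (n * b) ^ 2 := by
          rcases Nat.eq_zero_or_pos n with h0 | h0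
          · simp [h0]
          · have : (1 : ℝ) ≤ n := by exact_mod_cast h0
            rw [mul_pow]
            gcongr
            nlinarith
  exact le_of_sq_le_sq h1 (by positivity)

theorem one_le_jb (x : En n) : 1 ≤ jb x := by
  unfold jb
  rw [Real.one_le_sqrt]
  nlinarith [sq_nonneg ‖x‖]

theorem norm_le_jb (x : En n) : ‖x‖ ≤ jb x :=
  Real.le_sqrt_of_sq_le (by linarith)

theorem abs_pd_le (f : En n → ℝ) (j : Fin n) (x : En n) : |pd f j x| ≤ ‖fderiv ℝ f x‖ := by
  unfold pd
  have := (fderiv ℝ f x).le_opNorm (EuclideanSpace.single j 1)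
  simpa using this

theorem contDiff_pd {f : En n → ℝ} (hf : ContDiff ℝ (⊤ : ℕ∞) f) (j : Fin n) :
    ContDiff ℝ 1 (pd f j) := by
  unfold pd
  have h2 : ContDiff ℝ 2 f := contDiff_infty.mp hf 2
  exact (h2.fderiv_right (m := 1) one_add_one_eq_two.le).clm_apply contDiff_const

theorem fderiv_apply_eq_sum_pd (f : En n → ℝ) (x v : En n) :
    fderiv ℝ f x v = ∑ l, v l * pd f l x := by
  have hv : v = ∑ l, v l • EuclideanSpace.single l (1 : ℝ) := by
    ext j
    simp [Finset.sum_apply, Pi.single_apply]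
  conv_lhs => rw [hv]
  simp [pd]

theorem AssumptionA.exists_bounds (hA : AssumptionA n a V μ) :
    ∃ C > 0, ∀ x, (∀ j k, |a j k x - kdelta j k| ≤ C * jb x ^ (-μ)) ∧
      (∀ j k l, |pd (a j k) l x| ≤ C * jb x ^ (-μ - 1)) ∧ ∀ l, |pd V l x| ≤ C * jb x ^ (1 - μ) := by
  choose C₀ hC₀ h₀ using hA.decay_a 0
  choose C₁ hC₁ h₁ using hA.decay_a 1
  obtain ⟨C₂, hC₂, h₂⟩ := hA.decay_V 1
  have le₀ : ∀ j k, C₀ j k ≤ ∑ j, ∑ k, C₀ j k := fun j k =>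
    (Finset.single_le_sum (f := C₀ j) (fun k _ => (hC₀ j k).le) (Finset.mem_univ k)).trans
      (Finset.single_le_sum (f := fun j => ∑ k, C₀ j k)
        (fun j _ => Finset.sum_nonneg fun k _ => (hC₀ j k).le) (Finset.mem_univ j))
  have le₁ : ∀ j k, C₁ j k ≤ ∑ j, ∑ k, C₁ j k := fun j k =>
    (Finset.single_le_sum (f := C₁ j) (fun k _ => (hC₁ j k).le) (Finset.mem_univ k)).trans
      (Finset.single_le_sum (f := fun j => ∑ k, C₁ j k)
        (fun j _ => Finset.sum_nonneg fun k _ => (hC₁ j k).le) (Finset.mem_univ j))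
  have pos₀ : 0 ≤ ∑ j, ∑ k, C₀ j k :=
    Finset.sum_nonneg fun j _ => Finset.sum_nonneg fun k _ => (hC₀ j k).le
  have pos₁ : 0 ≤ ∑ j, ∑ k, C₁ j k :=
    Finset.sum_nonneg fun j _ => Finset.sum_nonneg fun k _ => (hC₁ j k).le
  refine ⟨(∑ j, ∑ k, C₀ j k) + (∑ j, ∑ k, C₁ j k) + C₂, by linarith, fun x => ⟨?_, ?_, ?_⟩⟩
  · intro j k
    have := h₀ j k x
    rw [norm_iteratedFDeriv_zero] at this
    simp only [Nat.cast_zero, sub_zero, Real.norm_eq_abs] at this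
    have hj : 0 ≤ jb x ^ (-μ) := Real.rpow_nonneg (Real.sqrt_nonneg _) _
    refine this.trans (mul_le_mul_of_nonneg_right ?_ hj)
    linarith [le₀ j k]
  · intro j k l
    have := h₁ j k x
    rw [norm_iteratedFDeriv_one, fderiv_sub_const] at this
    simp only [Nat.cast_one] at this
    have hj : 0 ≤ jb x ^ (-μ - 1) := Real.rpow_nonneg (Real.sqrt_nonneg _) _
    refine (abs_pd_le _ _ _).trans (this.trans (mul_le_mul_of_nonneg_right ?_ hj))
    linarith [le₁ j k]
  · intro l
    have := h₂ x
    rw [norm_iteratedFDeriv_one] at this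
    have he : 2 - μ - ((1 : ℕ) : ℝ) = 1 - μ := by
      push_cast
      ring
    rw [he] at this
    have hj : 0 ≤ jb x ^ (1 - μ) := Real.rpow_nonneg (Real.sqrt_nonneg _) _
    refine (abs_pd_le _ _ _).trans (this.trans (mul_le_mul_of_nonneg_right ?_ hj))
    linarith

theorem AssumptionA.exists_shortRange (hA : AssumptionA n a V μ) :
    ∃ C, ShortRange (metricDev a) (kineticGrad a) (pdGrad V) μ C := by
  obtain ⟨C, hC, hb⟩ := hA.exists_bounds
  have hμ := hA.one_lt_mu
  have hn : (1 : ℝ) ≤ n := by exact_mod_cast hA.n_pos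
  have hn1 : (n : ℝ) ≤ n ^ 3 := le_self_pow₀ hn (by norm_num)
  have hn2 : (n : ℝ) ^ 2 ≤ n ^ 3 := pow_le_pow_right₀ hn (by norm_num)
  have mono : ∀ {r : ℝ} {y : En n} {p : ℝ}, 0 < r → r ≤ ‖y‖ → p ≤ 0 → jb y ^ p ≤ r ^ p :=
    fun hr hy hp => Real.rpow_le_rpow_of_nonpos hr (hy.trans (norm_le_jb _)) hp
  have comp : ∀ (η : En n) i, |η i| ≤ ‖η‖ := fun η i => PiLp.norm_apply_le η i
  refine ⟨n ^ 3 * C, hμ, by positivity, ?_, ?_, ?_, ?_⟩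
  · intro r hr y η hy
    have hJ : 0 ≤ r ^ (-μ) := by positivity
    refine (norm_le_mul_of_abs_apply_le (b := n * (C * r ^ (-μ) * ‖η‖)) (by positivity) ?_).trans ?_
    · intro j
      rw [metricDev_apply]
      calc |∑ i, (a j i y - kdelta j i) * η i| ≤ ∑ i, |(a j i y - kdelta j i) * η i| :=
            Finset.abs_sum_le_sum_abs _ _
        _ ≤ ∑ _i : Fin n, C * r ^ (-μ) * ‖η‖ := by
            refine Finset.sum_le_sum fun i _ => ?_
            rw [abs_mul]
            refine mul_le_mul (((hb y).1 j i).trans ?_) (comp η i) (abs_nonneg _) (by positivity)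
            exact mul_le_mul_of_nonneg_left (mono hr hy (by linarith)) hC.le
        _ = n * (C * r ^ (-μ) * ‖η‖) := by simp
    · calc (n : ℝ) * (n * (C * r ^ (-μ) * ‖η‖)) = n ^ 2 * (C * r ^ (-μ) * ‖η‖) := by ring
        _ ≤ n ^ 3 * (C * r ^ (-μ) * ‖η‖) := by gcongr
        _ = n ^ 3 * C * r ^ (-μ) * ‖η‖ := by ring
  · intro r hr y η hy
    refine (norm_le_mul_of_abs_apply_le (b := n ^ 2 * (C * r ^ (-μ - 1) * ‖η‖ ^ 2))
      (by positivity) ?_).trans (le_of_eq (by ring))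
    intro j
    rw [kineticGrad_apply]
    have : |∑ i, ∑ l, pd (a i l) j y * η i * η l| ≤ n ^ 2 * (C * r ^ (-μ - 1) * ‖η‖ ^ 2) := by
      calc |∑ i, ∑ l, pd (a i l) j y * η i * η l|
          ≤ ∑ i, ∑ l, |pd (a i l) j y * η i * η l| :=
            (Finset.abs_sum_le_sum_abs _ _).trans
              (Finset.sum_le_sum fun i _ => Finset.abs_sum_le_sum_abs _ _)
        _ ≤ ∑ _i : Fin n, ∑ _l : Fin n, C * r ^ (-μ - 1) * ‖η‖ ^ 2 := by
            refine Finset.sum_le_sum fun i _ => Finset.sum_le_sum fun l _ => ?_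
            rw [abs_mul, abs_mul, sq, ← mul_assoc]
            have h1 : |pd (a i l) j y| ≤ C * r ^ (-μ - 1) := ((hb y).2.1 i l j).trans
              (mul_le_mul_of_nonneg_left (mono hr hy (by linarith)) hC.le)
            have := comp η i
            have := comp η l
            gcongr
        _ = n ^ 2 * (C * r ^ (-μ - 1) * ‖η‖ ^ 2) := by
            simp
            ring
    rw [abs_mul, abs_of_pos (by norm_num : (0 : ℝ) < 1 / 2)]
    linarith [abs_nonneg (∑ i, ∑ l, pd (a i l) j y * η i * η l)]
  · intro r hr y hy
    refine (norm_le_mul_of_abs_apply_le (b := C * r ^ (1 - μ)) (by positivity) ?_).trans ?_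
    · intro j
      exact ((hb y).2.2 j).trans (mul_le_mul_of_nonneg_left (mono hr hy (by linarith)) hC.le)
    · rw [← mul_assoc]
      gcongr
  · intro y
    refine (norm_le_mul_of_abs_apply_le (b := C) hC.le ?_).trans ?_
    · intro j
      exact ((hb y).2.2 j).trans (mul_le_of_le_one_right hC.le
        (Real.rpow_le_one_of_one_le_of_nonpos (one_le_jb y) (by linarith)))
    · gcongr

theorem AssumptionA.exists_lipschitzOnWith (hA : AssumptionA n a V μ) (B : ℝ) :
    ∃ K, LipschitzOnWith K (kineticField (metricDev a) (kineticGrad a)) (Metric.closedBall 0 B) := by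
  have hcomp : ∀ i, ContDiff ℝ 1 fun p : En n × En n => p.2 i := fun i => by fun_prop
  have ha : ∀ j i, ContDiff ℝ 1 fun p : En n × En n => a j i p.1 := fun j i =>
    ((hA.smooth_a j i).of_le (by exact_mod_cast le_top)).comp contDiff_fst
  have hpd : ∀ j i l, ContDiff ℝ 1 fun p : En n × En n => pd (a j i) l p.1 := fun j i l =>
    (contDiff_pd (hA.smooth_a j i) l).comp contDiff_fst
  have h : ContDiff ℝ 1 (kineticField (metricDev a) (kineticGrad a)) := by
    unfold kineticField
    refine ContDiff.prodMk (contDiff_snd.add ?_) (ContDiff.neg ?_)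
    · refine contDiff_euclidean.mpr fun j => ?_
      simp only [metricDev_apply]
      exact ContDiff.sum fun i _ => ((ha j i).sub contDiff_const).mul (hcomp i)
    · refine contDiff_euclidean.mpr fun j => ?_
      simp only [kineticGrad_apply]
      exact contDiff_const.mul (ContDiff.sum fun i _ => ContDiff.sum fun l _ =>
        ((hpd i l j).mul (hcomp i)).mul (hcomp l))
  obtain ⟨K, hK⟩ := (h.locallyLipschitz.locallyLipschitzOn
    (s := Metric.closedBall 0 B)).exists_lipschitzOnWith_of_compact (isCompact_closedBall _ _)
  exact ⟨K, hK⟩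

theorem inner_add_metricDev (y η : En n) :
    inner ℝ η (η + metricDev a y η) = ∑ j, ∑ i, a j i y * η j * η i := by
  rw [PiLp.inner_apply]
  refine Finset.sum_congr rfl fun j _ => ?_
  rw [add_metricDev_apply]
  simp only [RCLike.inner_apply, conj_trivial]
  rw [Finset.sum_mul]
  exact Finset.sum_congr rfl fun i _ => by ring

theorem AssumptionA.hasDerivAt_energy (hA : AssumptionA n a V μ) {W : En n → En n} {y η : ℝ → En n}
    (h : IsScaledSol (metricDev a) (kineticGrad a) W 0 y η) (s : ℝ) :
    HasDerivAt (fun s => inner ℝ (η s) (η s + metricDev a (y s) (η s))) 0 s := by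
  simp only [inner_add_metricDev]
  obtain ⟨v, hv⟩ : ∃ v, v = η s + metricDev a (y s) (η s) := ⟨_, rfl⟩
  have hvj : ∀ j, v j = ∑ i, a j i (y s) * η s i := fun j => by rw [hv, add_metricDev_apply]
  obtain ⟨w, hw⟩ : ∃ w, w = kineticGrad a (y s) (η s) := ⟨_, rfl⟩
  have hwj : ∀ l, w l = (1 / 2) * ∑ i, ∑ j, pd (a i j) l (y s) * η s i * η s j :=
    fun l => by rw [hw, kineticGrad_apply]
  have hy := h.1 s
  have hη := h.2 s
  rw [← hv] at hy
  rw [← hw] at hη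
  have hηj : ∀ j, HasDerivAt (fun s => η s j) (-w j) s := fun j => by
    have := (EuclideanSpace.proj (𝕜 := ℝ) j).hasFDerivAt.comp_hasDerivAt s hη
    simpa [Function.comp_def] using this
  have haj : ∀ j i, HasDerivAt (fun s => a j i (y s)) (∑ l, v l * pd (a j i) l (y s)) s :=
    fun j i => by
      rw [← fderiv_apply_eq_sum_pd]
      exact ((hA.smooth_a j i).differentiable (by simp) (y s)).hasFDerivAt.comp_hasDerivAt s hy
  have hd := HasDerivAt.fun_sum (u := Finset.univ) fun j _ =>
    HasDerivAt.fun_sum (u := Finset.univ) fun i _ => ((haj j i).mul (hηj j)).mul (hηj i)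
  convert! hd using 1
  have e1 : ∑ j, ∑ i, (∑ l, v l * pd (a j i) l (y s)) * η s j * η s i = 2 * ∑ l, v l * w l := by
    have hr : 2 * ∑ l, v l * w l =
        ∑ l, ∑ j, ∑ i, v l * pd (a j i) l (y s) * η s j * η s i := by
      simp only [hwj, Finset.mul_sum]
      refine Finset.sum_congr rfl fun l _ => Finset.sum_congr rfl fun j _ =>
        Finset.sum_congr rfl fun i _ => by ring
    rw [hr]
    symm
    rw [Finset.sum_comm]
    refine Finset.sum_congr rfl fun j _ => ?_
    rw [Finset.sum_comm]
    simp only [Finset.sum_mul]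
  have e2 : ∑ j, ∑ i, a j i (y s) * -w j * η s i = -∑ l, v l * w l := by
    simp only [hvj, Finset.sum_mul, ← Finset.sum_neg_distrib]
    exact Finset.sum_congr rfl fun j _ => Finset.sum_congr rfl fun i _ => by ring
  have e3 : ∑ j, ∑ i, a j i (y s) * η s j * -w i = -∑ l, v l * w l := by
    rw [Finset.sum_comm]
    simp only [hvj, Finset.sum_mul, ← Finset.sum_neg_distrib]
    refine Finset.sum_congr rfl fun j _ => Finset.sum_congr rfl fun i _ => ?_
    rw [hA.symm]
    ring
  have : ∑ j, ∑ i, (((∑ l, v l * pd (a j i) l (y s)) * η s j + a j i (y s) * -w j) * η s i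
      + a j i (y s) * η s j * -w i) = 2 * ∑ l, v l * w l + -∑ l, v l * w l + -∑ l, v l * w l := by
    rw [← e1]
    nth_rewrite 1 [← e2]
    rw [← e3]
    simp only [add_mul, Finset.sum_add_distrib]
  exact ((this.trans (by ring)).symm : (0 : ℝ) = _)

/-- The kinetic energy of an escaping trajectory is a positive constant. -/
theorem AssumptionA.exists_energy_eq (hA : AssumptionA n a V μ) {W : En n → En n} {y η : ℝ → En n}
    (h : IsScaledSol (metricDev a) (kineticGrad a) W 0 y η)
    (hy : Tendsto (fun s => ‖y s‖) atTop atTop) :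
    ∃ e > 0, ∀ s, inner ℝ (η s) (η s + metricDev a (y s) (η s)) = 2 * e ^ 2 := by
  have hconst : ∀ s, inner ℝ (η s) (η s + metricDev a (y s) (η s)) =
      inner ℝ (η 0) (η 0 + metricDev a (y 0) (η 0)) := fun s =>
    is_const_of_deriv_eq_zero (fun s => (hA.hasDerivAt_energy h s).differentiableAt)
      (fun s => (hA.hasDerivAt_energy h s).deriv) s 0
  have hpos : 0 < inner ℝ (η 0) (η 0 + metricDev a (y 0) (η 0)) := by
    by_contra! hle
    have hη : ∀ s, η s = 0 := by
      intro s
      by_contra hne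
      have := hA.posdef (y s) (η s) hne
      rw [← inner_add_metricDev, hconst] at this
      linarith
    have hy0 : ∀ s, HasDerivAt y 0 s := by
      intro s
      convert! h.1 s using 1
      rw [hη s]
      ext j
      rw [add_metricDev_apply]
      simp
    have hyc : ∀ s, y s = y 0 := fun s =>
      is_const_of_deriv_eq_zero (fun s => (hy0 s).differentiableAt) (fun s => (hy0 s).deriv) s 0
    simp only [hyc] at hy
    obtain ⟨s, hs⟩ := (hy.eventually_gt_atTop ‖y 0‖).exists
    exact lt_irrefl _ hs
  refine ⟨√(inner ℝ (η 0) (η 0 + metricDev a (y 0) (η 0)) / 2), by positivity, fun s => ?_⟩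
  rw [hconst, Real.sq_sqrt (by positivity)]
  ring

end

section

variable {n : ℕ} {a : Fin n → Fin n → En n → ℝ} {V : En n → ℝ}

theorem hasDerivAt_of_apply {f : ℝ → En n} {f' : En n} {t : ℝ}
    (h : ∀ j, HasDerivAt (fun s => f s j) (f' j) t) : HasDerivAt f f' t := by
  rw [hasDerivAt_iff_hasFDerivAt, ← hasFDerivWithinAt_univ, hasFDerivWithinAt_euclidean]
  intro j
  rw [hasFDerivWithinAt_univ]
  convert! (h j).hasFDerivAt using 1

theorem kineticGrad_smul (y η : En n) (c : ℝ) :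
    kineticGrad a y (c • η) = c ^ 2 • kineticGrad a y η := by
  ext j
  simp only [PiLp.smul_apply, kineticGrad_apply, smul_eq_mul, Finset.mul_sum]
  exact Finset.sum_congr rfl fun i _ => Finset.sum_congr rfl fun l _ => by ring

theorem metricDev_smul (y η : En n) (c : ℝ) : metricDev a y (c • η) = c • metricDev a y η := by
  ext j
  simp only [PiLp.smul_apply, metricDev_apply, smul_eq_mul, Finset.mul_sum]
  exact Finset.sum_congr rfl fun i _ => by ring

theorem IsFlowK.hasDerivAt {y η : ℝ → En n} (h : IsFlowK a y η) (t : ℝ) :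
    HasDerivAt y (η t + metricDev a (y t) (η t)) t ∧
      HasDerivAt η (-kineticGrad a (y t) (η t)) t := by
  refine ⟨hasDerivAt_of_apply fun j => ?_, hasDerivAt_of_apply fun j => ?_⟩
  · rw [add_metricDev_apply]
    exact h.1 t j
  · exact h.2 t j

theorem IsFlowP.hasDerivAt {y η : ℝ → En n} (h : IsFlowP a V y η) (t : ℝ) :
    HasDerivAt y (η t + metricDev a (y t) (η t)) t ∧
      HasDerivAt η (-(kineticGrad a (y t) (η t) + y t + pdGrad V (y t))) t := by
  refine ⟨hasDerivAt_of_apply fun j => ?_, hasDerivAt_of_apply fun j => ?_⟩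
  · rw [add_metricDev_apply]
    exact h.1 t j
  · exact h.2 t j

theorem IsFlowK.isScaledSol {y η : ℝ → En n} (h : IsFlowK a y η) (W : En n → En n) :
    IsScaledSol (metricDev a) (kineticGrad a) W 0 (fun s => y (-s)) (fun s => -η (-s)) := by
  have hneg : ∀ s : ℝ, HasDerivAt (fun s : ℝ => -s) (-1) s := fun s => hasDerivAt_neg s
  refine ⟨fun s => ?_, fun s => ?_⟩
  · convert! (h.hasDerivAt (-s)).1.scomp s (hneg s) using 1
    dsimp only
    rw [← neg_one_smul ℝ (η (-s)), metricDev_smul, smul_add]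
  · convert! ((h.hasDerivAt (-s)).2.scomp s (hneg s)).neg using 1
    dsimp only
    rw [← neg_one_smul ℝ (η (-s)), kineticGrad_smul]
    simp

theorem IsFlowP.isScaledSol {y η : ℝ → En n} (h : IsFlowP a V y η) (ε : ℝ) :
    IsScaledSol (metricDev a) (kineticGrad a) (pdGrad V) ε (fun s => y (-(ε * s)))
      (fun s => -(ε • η (-(ε * s)))) := by
  have hneg : ∀ s : ℝ, HasDerivAt (fun s : ℝ => -(ε * s)) (-ε) s := fun s => by
    simpa using ((hasDerivAt_id' s).const_mul ε).fun_neg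
  refine ⟨fun s => ?_, fun s => ?_⟩
  · convert! (h.hasDerivAt (-(ε * s))).1.scomp s (hneg s) using 1
    dsimp only
    rw [← neg_smul, metricDev_smul, smul_add]
  · convert! (((h.hasDerivAt (-(ε * s))).2.scomp s (hneg s)).const_smul ε).neg using 1
    dsimp only
    rw [← neg_smul, kineticGrad_smul]
    module

end

/-- Theorem 2.4 (ii). Under Assumption A, if `(x₀,ξ₀)` is backward
nontrapping for `k` and `−π < σ < 0`, there is a neighborhood `Ω` of `(x₀,ξ₀)` on which the
classical wave operator `S₋` exists and, uniformly for `(x,ξ) ∈ Ω`,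
`π₁(exp(−σH_{p₀}) ∘ exp(σH_p)(x,λξ)) → π₁(S₋(x,ξ))` and
`λ⁻¹ π₂(exp(−σH_{p₀}) ∘ exp(σH_p)(x,λξ)) → π₂(S₋(x,ξ))` as `λ → ∞`. -/
theorem stmt_14 {n : ℕ} (a : Fin n → Fin n → En n → ℝ) (V : En n → ℝ) (μ : ℝ)
    (hA : AssumptionA n a V μ)
    -- a global Hamilton flow for k:
    (Yk Hk : En n → En n → ℝ → En n)
    (hKflow : ∀ x ξ : En n, IsFlowK a (Yk x ξ) (Hk x ξ) ∧ Yk x ξ 0 = x ∧ Hk x ξ 0 = ξ)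
    -- a global Hamilton flow for p:
    (Yp Hp : En n → En n → ℝ → En n)
    (hPflow : ∀ x ξ : En n, IsFlowP a V (Yp x ξ) (Hp x ξ) ∧ Yp x ξ 0 = x ∧ Hp x ξ 0 = ξ)
    -- (x₀,ξ₀) backward nontrapping:
    (x₀ ξ₀ : En n)
    (hnt : Filter.Tendsto (fun t => ‖Yk x₀ ξ₀ t‖) Filter.atBot Filter.atTop)
    (σ : ℝ) (hσπ : -π < σ) (hσ0 : σ < 0) :
    ∃ Ω : Set (En n × En n), IsOpen Ω ∧ (x₀, ξ₀) ∈ Ω ∧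
      ∃ Sm : En n × En n → En n × En n,
        (∀ q ∈ Ω, Filter.Tendsto
            (fun t : ℝ => (Yk q.1 q.2 t - t • Hk q.1 q.2 t, Hk q.1 q.2 t))
            Filter.atBot (nhds (Sm q))) ∧
        TendstoUniformlyOn
          (fun (lam : ℝ) (q : En n × En n) =>
            (Real.cos σ • Yp q.1 (lam • q.2) σ - Real.sin σ • Hp q.1 (lam • q.2) σ,
             lam⁻¹ • (Real.sin σ • Yp q.1 (lam • q.2) σ + Real.cos σ • Hp q.1 (lam • q.2) σ)))
          Sm Filter.atTop Ω := by
  obtain ⟨C, hS⟩ := hA.exists_shortRange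
  obtain ⟨Y, hY⟩ : ∃ Y : ℝ → En n × En n → ℝ → En n, Y = fun ε q s =>
    if ε = 0 then Yk q.1 (-q.2) (-s) else Yp q.1 (ε⁻¹ • -q.2) (-(ε * s)) := ⟨_, rfl⟩
  obtain ⟨H, hH⟩ : ∃ H : ℝ → En n × En n → ℝ → En n, H = fun ε q s =>
    if ε = 0 then -Hk q.1 (-q.2) (-s) else -(ε • Hp q.1 (ε⁻¹ • -q.2) (-(ε * s))) := ⟨_, rfl⟩
  have hY0 : ∀ q, Y 0 q = fun s => Yk q.1 (-q.2) (-s) := fun q => by simp [hY]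
  have hH0 : ∀ q, H 0 q = fun s => -Hk q.1 (-q.2) (-s) := fun q => by simp [hH]
  have hY1 : ∀ ε, ε ≠ 0 → ∀ q, Y ε q = fun s => Yp q.1 (ε⁻¹ • -q.2) (-(ε * s)) :=
    fun ε hε q => by simp [hY, hε]
  have hH1 : ∀ ε, ε ≠ 0 → ∀ q, H ε q = fun s => -(ε • Hp q.1 (ε⁻¹ • -q.2) (-(ε * s))) :=
    fun ε hε q => by simp [hH, hε]
  have hsol : ∀ ε, 0 ≤ ε → ∀ q, IsScaledSol (metricDev a) (kineticGrad a) (pdGrad V) ε (Y ε q)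
      (H ε q) ∧ Y ε q 0 = q.1 ∧ H ε q 0 = q.2 := by
    intro ε _ q
    rcases eq_or_ne ε 0 with rfl | hε
    · obtain ⟨h, h1, h2⟩ := hKflow q.1 (-q.2)
      rw [hY0, hH0]
      exact ⟨h.isScaledSol _, by simp [h1], by simp [h2]⟩
    · obtain ⟨h, h1, h2⟩ := hPflow q.1 (ε⁻¹ • -q.2)
      rw [hY1 ε hε, hH1 ε hε]
      refine ⟨h.isScaledSol _, by simp only [mul_zero, neg_zero, h1], ?_⟩
      simp only [mul_zero, neg_zero, h2]
      rw [smul_inv_smul₀ hε, neg_neg]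
  have hesc : Tendsto (fun s => ‖Y 0 (x₀, -ξ₀) s‖) atTop atTop := by
    rw [hY0]
    simpa only [neg_neg, Function.comp_def] using hnt.comp tendsto_neg_atTop_atBot
  have h0 := (hsol 0 le_rfl (x₀, -ξ₀)).1
  obtain ⟨e, he, hen⟩ := hA.exists_energy_eq h0 hesc
  obtain ⟨Ω, hΩ, hmem, S, hlim, hunif⟩ := hS.exists_waveMap hA.exists_lipschitzOnWith
    (neg_pos.mpr hσ0) (neg_lt.mp hσπ) Y H hsol (x₀, -ξ₀) he
    (hS.exists_outgoing h0 hesc he hen)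
  obtain ⟨flip, hflip⟩ : ∃ flip : En n × En n → En n × En n, flip = fun q => (q.1, -q.2) :=
    ⟨_, rfl⟩
  have hcont : Continuous flip := by
    rw [hflip]
    fun_prop
  have hdist : ∀ p q, dist (flip p) (flip q) = dist p q := fun p q => by
    simp [hflip, Prod.dist_eq]
  refine ⟨flip ⁻¹' Ω, hΩ.preimage hcont, by simpa [hflip] using hmem, fun q => flip (S (flip q)),
    fun q hq => ?_, ?_⟩
  · have := ((hcont.tendsto _).comp (hlim _ hq)).comp tendsto_neg_atBot_atTop
    convert! this using 1
    funext t
    simp [Function.comp_def, pull, pullPos, pullMom, hY0, hH0, hflip, oscSin, sub_eq_add_neg]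
  · rw [Metric.tendstoUniformlyOn_iff] at hunif ⊢
    intro δ hδ
    filter_upwards [tendsto_inv_atTop_nhdsGT_zero.eventually (hunif δ hδ), eventually_gt_atTop 0]
      with lam hl hlam q hq
    have hd := hl (flip q) hq
    have hinv : lam⁻¹ ≠ 0 := inv_ne_zero hlam.ne'
    have ht : lam⁻¹ * (-σ / lam⁻¹) = -σ := mul_div_cancel₀ _ hinv
    rw [← hdist] at hd
    convert hd using 2
    rw [hY1 _ hinv, hH1 _ hinv]
    simp only [pull, pullPos, pullMom, oscSin, if_neg hinv, hflip, ht, neg_neg, inv_inv,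
      Real.cos_neg, Real.sin_neg]
    refine Prod.ext ?_ ?_
    · simp only
      match_scalars <;> field_simp
    · simp only
      match_scalars <;> field_simp
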